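/- arXiv:1902.03571 — 8 statements merged into one kernel-verified Lean document; each statement's English description precedes it below -/
import Mathlib

section
/- For every point (x, y) of the closed unit quarter circle (x ≥ 0, y ≥ 0, x² + y² = 1), one has 3 − 2x − 2y > 0, and the point T(x, y) = (|2 − x − 2y|/(3 − 2x − 2y), |2 − 2x − y|/(3 − 2x − 2y)) again lies on the closed unit quarter circle, i.e. both of its coordinates are nonnegative and their squares sum to 1. -/
/-- The Romik map on the plane (restricting to the closed unit quarter circle). -/
noncomputable def RomikT (p : ℝ × ℝ) : ℝ × ℝ :=
  (|2 - p.1 - 2 * p.2| / (3 - 2 * p.1 - 2 * p.2),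
   |2 - 2 * p.1 - p.2| / (3 - 2 * p.1 - 2 * p.2))

theorem stmt_0 (x y : ℝ) (hx : 0 ≤ x) (hy : 0 ≤ y) (hxy : x ^ 2 + y ^ 2 = 1) :
    0 < 3 - 2 * x - 2 * y ∧
    0 ≤ (RomikT (x, y)).1 ∧ 0 ≤ (RomikT (x, y)).2 ∧
    (RomikT (x, y)).1 ^ 2 + (RomikT (x, y)).2 ^ 2 = 1 := by
  have hpos : 0 < 3 - 2 * x - 2 * y := by nlinarith [sq_nonneg (x - y), sq_nonneg (x + y)]
  refine ⟨hpos, div_nonneg (abs_nonneg _) hpos.le, div_nonneg (abs_nonneg _) hpos.le, ?_⟩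
  simp only [RomikT]
  rw [div_pow, div_pow, sq_abs, sq_abs, ← add_div, div_eq_one_iff_eq (pow_pos hpos 2).ne']
  linear_combination hxy
end

section
/- Let v = (a, b, c) ∈ ℝ³ with c ≠ 0, and write H·v = (a', b', c'). Then 1 < a/c + b/c < 2 if and only if |c'| < |c|. -/
/-- The reflection H = s_{(1,1,1)}. -/
def Hmat : Matrix (Fin 3) (Fin 3) ℝ := !![-1, -2, 2; -2, -1, 2; -2, -2, 3]

theorem stmt_2 (a b c : ℝ) (hc : c ≠ 0) :
    (1 < a / c + b / c ∧ a / c + b / c < 2) ↔ |Hmat.mulVec ![a, b, c] 2| < |c| := by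
  have h : Hmat.mulVec ![a, b, c] 2 = (3 - 2 * (a / c + b / c)) * c := by
    simp only [Hmat, Matrix.mulVec, dotProduct, Fin.sum_univ_three, Matrix.of_apply,
      Matrix.cons_val]
    field_simp
    ring
  rw [h, abs_mul, mul_lt_iff_lt_one_left (abs_pos.mpr hc), abs_lt]
  constructor <;> rintro ⟨h₁, h₂⟩ <;> constructor <;> linarith
end

section
/- Let (a, b, c) be a primitive Pythagorean triple. Then for each j ∈ {1, 2, 3}, the triple M_j·(a, b, c) =: (a', b', c') is again a primitive Pythagorean triple (a', b', c' are positive integers with gcd 1 and a'² + b'² = c'²), and moreover c' > c. -/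
/-- The Berggren matrices M₁, M₂, M₃ (indexed by `Fin 3`, so `Mmat 0 = M₁`, etc.). -/
def Mmat : Fin 3 → Matrix (Fin 3) (Fin 3) ℤ :=
  ![!![-1, 2, 2; -2, 1, 2; -2, 2, 3],
    !![1, 2, 2; 2, 1, 2; 2, 2, 3],
    !![1, -2, 2; 2, -1, 2; 2, -2, 3]]

/-- `(a, b, c)` is a primitive Pythagorean triple. -/
def IsPPT (a b c : ℤ) : Prop :=
  0 < a ∧ 0 < b ∧ 0 < c ∧ Int.gcd (Int.gcd a b) c = 1 ∧ a ^ 2 + b ^ 2 = c ^ 2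

theorem gcd_gcd_eq_one_iff (a b c : ℤ) :
    Int.gcd (Int.gcd a b) c = 1 ↔ ∀ d : ℤ, d ∣ a → d ∣ b → d ∣ c → d ∣ 1 := by
  constructor
  · intro h d ha hb hc
    have hd := Int.dvd_coe_gcd (Int.dvd_coe_gcd ha hb) hc
    rwa [h, Nat.cast_one] at hd
  · intro h
    have hd := Int.gcd_dvd_left (Int.gcd a b : ℤ) c
    have := h (Int.gcd (Int.gcd a b) c) (hd.trans (Int.gcd_dvd_left a b))
      (hd.trans (Int.gcd_dvd_right a b)) (Int.gcd_dvd_right _ _)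
    exact Nat.dvd_one.mp (by exact_mod_cast this)

/-- If the old triple is an integer combination of the new one, primitivity is preserved. -/
theorem gcd_gcd_eq_one_of_combination {a b c x y z : ℤ} (h : Int.gcd (Int.gcd a b) c = 1)
    (ha : ∃ p q r : ℤ, a = p * x + q * y + r * z) (hb : ∃ p q r : ℤ, b = p * x + q * y + r * z)
    (hc : ∃ p q r : ℤ, c = p * x + q * y + r * z) : Int.gcd (Int.gcd x y) z = 1 := by
  rw [gcd_gcd_eq_one_iff] at h ⊢
  intro d hx hy hz
  have key : ∀ t : ℤ, (∃ p q r : ℤ, t = p * x + q * y + r * z) → d ∣ t := by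
    rintro t ⟨p, q, r, rfl⟩
    exact dvd_add (dvd_add (hx.mul_left p) (hy.mul_left q)) (hz.mul_left r)
  exact h d (key a ha) (key b hb) (key c hc)

theorem stmt_4 (a b c : ℤ) (h : IsPPT a b c) (j : Fin 3) :
    IsPPT ((Mmat j).mulVec ![a, b, c] 0) ((Mmat j).mulVec ![a, b, c] 1)
      ((Mmat j).mulVec ![a, b, c] 2) ∧
    c < (Mmat j).mulVec ![a, b, c] 2 := by
  obtain ⟨ha, hb, hc, hg, hp⟩ := h
  have hac : a < c := by nlinarith
  have hbc : b < c := by nlinarith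
  fin_cases j <;>
    simp only [Mmat, IsPPT, Matrix.mulVec, dotProduct, Fin.sum_univ_three, Fin.zero_eta,
      Fin.mk_one, Fin.reduceFinMk, Matrix.cons_val, Matrix.of_apply]
  · exact ⟨⟨by linarith, by linarith, by linarith,
      gcd_gcd_eq_one_of_combination hg ⟨-1, -2, 2, by ring⟩ ⟨2, 1, -2, by ring⟩
        ⟨-2, -2, 3, by ring⟩, by linear_combination hp⟩, by linarith⟩
  · exact ⟨⟨by linarith, by linarith, by linarith,
      gcd_gcd_eq_one_of_combination hg ⟨1, 2, -2, by ring⟩ ⟨2, 1, -2, by ring⟩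
        ⟨-2, -2, 3, by ring⟩, by linear_combination hp⟩, by linarith⟩
  · exact ⟨⟨by linarith, by linarith, by linarith,
      gcd_gcd_eq_one_of_combination hg ⟨1, 2, -2, by ring⟩ ⟨-2, -1, 2, by ring⟩
        ⟨-2, -2, 3, by ring⟩, by linear_combination hp⟩, by linarith⟩
end

section
/- Let D be a squarefree integer with D ≥ 2, let K = ℚ(√D) viewed as a subfield of ℝ, and let σ denote the nontrivial field automorphism of K (sending √D to −√D), applied to vectors coordinatewise. Let v ∈ K³ satisfy Q(v) = 0, suppose each coordinate of v is integral over ℤ (i.e. lies in the ring of integers of K), and suppose v and v^σ are linearly independent over ℝ. Then each coordinate of v ×_Q v^σ is of the form m·√D/2 for some integer m. -/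
/-- The Pythagorean quadratic form on ℝ³. -/
def Qf (v : Fin 3 → ℝ) : ℝ := v 0 ^ 2 + v 1 ^ 2 - v 2 ^ 2

/-- The Q-cross product `v ×_Q w`. -/
def qcross (v w : Fin 3 → ℝ) : Fin 3 → ℝ :=
  ![v 1 * w 2 - w 1 * v 2, w 0 * v 2 - v 0 * w 2, w 0 * v 1 - v 0 * w 1]

/-- The square root of a squarefree integer `D ≥ 2` is irrational. -/
theorem irrational_sqrt_of_squarefree {D : ℤ} (hD : Squarefree D) (hD2 : 2 ≤ D) :
    Irrational (Real.sqrt (D : ℝ)) := by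
  rw [irrational_sqrt_intCast_iff]
  refine ⟨?_, by omega⟩
  rintro ⟨r, rfl⟩
  rcases Int.isUnit_iff.1 (hD r dvd_rfl) with rfl | rfl <;> omega

/-- Conjugate elements of a real quadratic field take conjugate values under an integer
polynomial. -/
theorem exists_aeval_conj (D : ℤ) (hD : 0 ≤ D) (p q : ℚ) (P : Polynomial ℤ) :
    ∃ a b : ℚ, Polynomial.aeval ((p : ℝ) + q * Real.sqrt D) P = a + b * Real.sqrt D ∧
      Polynomial.aeval ((p : ℝ) - q * Real.sqrt D) P = a - b * Real.sqrt D := by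
  have hs : Real.sqrt (D : ℝ) * Real.sqrt D = D := Real.mul_self_sqrt (by exact_mod_cast hD)
  induction P using Polynomial.induction_on with
  | C n => exact ⟨n, 0, by simp, by simp⟩
  | add P R hP hR =>
    obtain ⟨a, b, h₁, h₂⟩ := hP
    obtain ⟨c, d, h₃, h₄⟩ := hR
    refine ⟨a + c, b + d, ?_, ?_⟩
    · rw [map_add, h₁, h₃]; push_cast; ring
    · rw [map_add, h₂, h₄]; push_cast; ring
  | monomial n c ih =>
    obtain ⟨a, b, h₁, h₂⟩ := ih
    refine ⟨a * p + b * q * D, a * q + b * p, ?_, ?_⟩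
    · rw [pow_succ, ← mul_assoc, map_mul, h₁, Polynomial.aeval_X]
      push_cast
      linear_combination (b * q : ℝ) * hs
    · rw [pow_succ, ← mul_assoc, map_mul, h₂, Polynomial.aeval_X]
      push_cast
      linear_combination (b * q : ℝ) * hs

/-- The conjugate of an integral element of a real quadratic field is integral. -/
theorem isIntegral_conj {D : ℤ} (hD : Squarefree D) (hD2 : 2 ≤ D) {p q : ℚ}
    (h : IsIntegral ℤ ((p : ℝ) + q * Real.sqrt D)) :
    IsIntegral ℤ ((p : ℝ) - q * Real.sqrt D) := by
  obtain ⟨P, hP, hP0⟩ := h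
  obtain ⟨a, b, h₁, h₂⟩ := exists_aeval_conj D (by omega) p q P
  refine ⟨P, hP, ?_⟩
  rw [← Polynomial.aeval_def] at hP0 ⊢
  rw [h₁] at hP0
  have hb : b = 0 := by
    by_contra hb
    exact ((irrational_sqrt_of_squarefree hD hD2).ratCast_mul hb).ratCast_add a |>.ne_zero hP0
  subst hb
  rw [h₂]
  simpa using hP0

/-- A rational number integral over `ℤ` as a real number is an integer. -/
theorem exists_int_eq_of_isIntegral_real {r : ℚ} (h : IsIntegral ℤ (r : ℝ)) :
    ∃ n : ℤ, r = n := by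
  have h' : IsIntegral ℤ r :=
    (isIntegral_algHom_iff (Rat.castHom ℝ).toIntAlgHom Rat.cast_injective).1 h
  obtain ⟨n, hn⟩ := IsIntegrallyClosed.isIntegral_iff.1 h'
  exact ⟨n, by simpa using hn.symm⟩

/-- If `D` is squarefree and `t ^ 2 * D` is an integer, then so is the rational number `t`. -/
theorem exists_int_eq_of_sq_mul_squarefree {D : ℤ} (hD : Squarefree D) {t : ℚ} {n : ℤ}
    (h : t ^ 2 * D = n) : ∃ m : ℤ, t = m := by
  have hmul : D * t.num ^ 2 = n * (t.den : ℤ) ^ 2 := by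
    have ht : t * t.den = t.num := Rat.mul_den_eq_num t
    have : (D : ℚ) * (t.num : ℚ) ^ 2 = n * (t.den : ℚ) ^ 2 := by
      rw [← ht, ← h]; ring
    exact_mod_cast this
  have hcop : IsCoprime ((t.den : ℤ) ^ 2) (t.num ^ 2) :=
    (Rat.isCoprime_num_den t).symm.pow
  have hdvd : (t.den : ℤ) * t.den ∣ D := by
    rw [← sq]
    exact hcop.dvd_of_dvd_mul_right ⟨n, by rw [hmul]; ring⟩
  have hone : t.den = 1 := by simpa using Int.isUnit_iff_natAbs_eq.1 (hD _ hdvd)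
  exact ⟨t.num, (Rat.coe_int_num_of_den_eq_one hone).symm⟩

/-- An integral element of a real quadratic field has half-integral coordinates. -/
theorem exists_half_int_of_isIntegral {D : ℤ} (hD : Squarefree D) (hD2 : 2 ≤ D) {p q : ℚ}
    (h : IsIntegral ℤ ((p : ℝ) + q * Real.sqrt D)) :
    ∃ a b : ℤ, (p : ℝ) = a / 2 ∧ (q : ℝ) = b / 2 := by
  have hs : Real.sqrt (D : ℝ) * Real.sqrt D = D :=
    Real.mul_self_sqrt (by exact_mod_cast (by omega : 0 ≤ D))
  have hc := isIntegral_conj hD hD2 h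
  obtain ⟨a, ha⟩ := exists_int_eq_of_isIntegral_real (r := 2 * p) (by
    have hsum : ((2 * p : ℚ) : ℝ) = (p + q * Real.sqrt D) + (p - q * Real.sqrt D) := by
      push_cast
      ring
    exact hsum ▸ h.add hc)
  obtain ⟨n, hn⟩ := exists_int_eq_of_isIntegral_real (r := p ^ 2 - D * q ^ 2) (by
    have hprod : ((p ^ 2 - D * q ^ 2 : ℚ) : ℝ) =
        (p + q * Real.sqrt D) * (p - q * Real.sqrt D) := by
      push_cast
      linear_combination (q : ℝ) ^ 2 * hs
    exact hprod ▸ h.mul hc)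
  obtain ⟨b, hb⟩ := exists_int_eq_of_sq_mul_squarefree hD (t := 2 * q) (n := a ^ 2 - 4 * n) (by
    push_cast
    rw [← ha, ← hn]
    ring)
  refine ⟨a, b, ?_, ?_⟩
  · have : (2 * p : ℝ) = a := by exact_mod_cast ha
    linarith
  · have : (2 * q : ℝ) = b := by exact_mod_cast hb
    linarith

theorem stmt_12 (D : ℤ) (hD : Squarefree D) (hD2 : 2 ≤ D)
    (p q : Fin 3 → ℚ) (v vσ : Fin 3 → ℝ)
    (hv : ∀ i, v i = (p i : ℝ) + (q i : ℝ) * Real.sqrt (D : ℝ))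
    (hvσ : ∀ i, vσ i = (p i : ℝ) - (q i : ℝ) * Real.sqrt (D : ℝ))
    (hQ : Qf v = 0)
    (hint : ∀ i, IsIntegral ℤ (v i))
    (hli : LinearIndependent ℝ ![v, vσ]) :
    ∀ i, ∃ m : ℤ, qcross v vσ i = (m : ℝ) * Real.sqrt (D : ℝ) / 2 := by
  choose a b ha hb using fun i => exists_half_int_of_isIntegral hD hD2 (hv i ▸ hint i)
  have minor (i j : Fin 3) : v i * vσ j - vσ i * v j =
      ((b i * a j - a i * b j : ℤ) : ℝ) * Real.sqrt (D : ℝ) / 2 := by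
    rw [hv, hv, hvσ, hvσ, ha, ha, hb, hb]
    push_cast
    ring
  intro i
  fin_cases i
  · exact ⟨_, minor 1 2⟩
  · exact ⟨_, (by simp [qcross]; ring : _ = v 2 * vσ 0 - vσ 2 * v 0).trans (minor 2 0)⟩
  · exact ⟨_, (by simp [qcross]; ring : _ = v 1 * vσ 0 - vσ 1 * v 0).trans (minor 1 0)⟩
end

section
/- Let P = (α, β) be a point of the closed unit quarter circle with P ≠ (1, 0) and P ≠ (0, 1), and suppose T^k(P) = P for some integer k ≥ 1 (P is purely periodic for the Romik map). Then there exist a squarefree integer D ≥ 2 and rationals a, b, c, e such that α = a + b·√D and β = c + e·√D; that is, P is defined over a real quadratic field. -/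
/-- The rational parametrization of the unit circle by the tangent of the half angle. -/
noncomputable def circlePoint (t : ℝ) : ℝ × ℝ :=
  ((1 - t ^ 2) / (1 + t ^ 2), 2 * t / (1 + t ^ 2))

lemma circlePoint_injective : Function.Injective circlePoint := by
  have key (t : ℝ) : (circlePoint t).2 / (1 + (circlePoint t).1) = t := by
    have h : 1 + t ^ 2 ≠ 0 := by positivity
    simp only [circlePoint]
    field_simp
    ring
  intro s t hst
  rw [← key s, hst, key t]

lemma exists_eq_circlePoint {α β : ℝ} (hα : 0 ≤ α) (hβ : 0 ≤ β) (h : α ^ 2 + β ^ 2 = 1) :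
    ∃ t, 0 ≤ t ∧ t ≤ 1 ∧ (α, β) = circlePoint t := by
  have hα' : 0 < 1 + α := by linarith
  refine ⟨β / (1 + α), by positivity, ?_, ?_⟩
  · rw [div_le_one hα']
    nlinarith
  · have h1 : 1 + (β / (1 + α)) ^ 2 = 2 / (1 + α) := by
      field_simp
      linarith
    have h2 : 1 - (β / (1 + α)) ^ 2 = 2 * α / (1 + α) := by
      field_simp
      linarith
    simp only [circlePoint, h1, h2, Prod.mk.injEq]
    constructor <;> field_simp

lemma RomikT_circlePoint (t : ℝ) :
    RomikT (circlePoint t) =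
      (|(2 * t - 1) ^ 2 - t ^ 2| / ((2 * t - 1) ^ 2 + t ^ 2),
        |2 * t * (2 * t - 1)| / ((2 * t - 1) ^ 2 + t ^ 2)) := by
  have h : 0 < 1 + t ^ 2 := by positivity
  have e1 : 2 - (1 - t ^ 2) / (1 + t ^ 2) - 2 * (2 * t / (1 + t ^ 2))
      = ((2 * t - 1) ^ 2 - t ^ 2) / (1 + t ^ 2) := by
    field_simp
    ring
  have e2 : 2 - 2 * ((1 - t ^ 2) / (1 + t ^ 2)) - 2 * t / (1 + t ^ 2)
      = 2 * t * (2 * t - 1) / (1 + t ^ 2) := by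
    field_simp
    ring
  have e3 : 3 - 2 * ((1 - t ^ 2) / (1 + t ^ 2)) - 2 * (2 * t / (1 + t ^ 2))
      = ((2 * t - 1) ^ 2 + t ^ 2) / (1 + t ^ 2) := by
    field_simp
    ring
  simp only [RomikT, circlePoint, e1, e2, e3, abs_div, abs_of_pos h,
    div_div_div_cancel_right₀ h.ne']

lemma circlePoint_div {u v : ℝ} (hv : v ≠ 0) :
    circlePoint (u / v) = ((v ^ 2 - u ^ 2) / (v ^ 2 + u ^ 2), 2 * u * v / (v ^ 2 + u ^ 2)) := by
  have h : v ^ 2 + u ^ 2 ≠ 0 := by positivity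
  have h1 : 1 + (u / v) ^ 2 = (v ^ 2 + u ^ 2) / v ^ 2 := by field_simp
  have h2 : 1 - (u / v) ^ 2 = (v ^ 2 - u ^ 2) / v ^ 2 := by field_simp
  simp only [circlePoint, h1, h2, Prod.mk.injEq]
  constructor <;> field_simp

/-- In the homogeneous coordinates `(t, 1 - t)`, each inverse branch of the Romik map is given by
one of the matrices `!![1, 0; 2, 1]`, `!![1, 1; 2, 1]`, `!![1, 1; 0, 1]`. -/
lemma exists_RomikT_circlePoint_eq {t : ℝ} (h0 : 0 ≤ t) (h1 : t ≤ 1) :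
    ∃ s, 0 ≤ s ∧ s ≤ 1 ∧ RomikT (circlePoint t) = circlePoint s ∧
      ∃ m n : ℕ, 1 ≤ m + n ∧ ∃ c : ℝ,
        t = c * (s + m * (1 - s)) ∧ 1 - t = c * (n * s + (1 - s)) := by
  rw [RomikT_circlePoint]
  rcases le_total t (1 / 3) with h3 | h3
  · have hp : 0 < 1 - 2 * t := by linarith
    have hp' : 1 - 2 * t ≠ 0 := hp.ne'
    have hcancel : (1 - 2 * t) * (t / (1 - 2 * t)) = t := mul_div_cancel₀ t hp'
    refine ⟨t / (1 - 2 * t), by positivity, (div_le_one hp).2 (by linarith), ?_,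
      0, 2, by norm_num, 1 - 2 * t, ?_, ?_⟩
    · rw [circlePoint_div hp', abs_of_nonneg (by nlinarith), abs_of_nonpos (by nlinarith)]
      congr 2 <;> ring
    · push_cast
      linear_combination -hcancel
    · push_cast
      linear_combination -hcancel
  have ht : 0 < t := by linarith
  rcases le_total t (1 / 2) with h2 | h2
  · refine ⟨(1 - 2 * t) / t, div_nonneg (by linarith) h0, (div_le_one ht).2 (by linarith), ?_,
      1, 2, by norm_num, t, ?_, ?_⟩
    · rw [circlePoint_div ht.ne', abs_of_nonpos (by nlinarith), abs_of_nonpos (by nlinarith)]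
      congr 2 <;> ring
    · push_cast
      field_simp
      ring
    · push_cast
      field_simp
      ring
  · refine ⟨(2 * t - 1) / t, div_nonneg (by linarith) h0, (div_le_one ht).2 (by linarith), ?_,
      1, 0, by norm_num, t, ?_, ?_⟩
    · rw [circlePoint_div ht.ne', abs_of_nonpos (by nlinarith), abs_of_nonneg (by nlinarith)]
      congr 2 <;> ring
    · push_cast
      field_simp
      ring
    · push_cast
      field_simp
      ring

/-- In the homogeneous coordinates `(t, 1 - t)`, the inverse branches of the iterates of the Romik
map are given by non-scalar matrices with nonnegative integer entries. -/
lemma exists_iterate_RomikT_circlePoint_eq (k : ℕ) {t : ℝ} (h0 : 0 ≤ t) (h1 : t ≤ 1) :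
    ∃ s, RomikT^[k] (circlePoint t) = circlePoint s ∧
      ∃ p q r w : ℕ, 1 ≤ p ∧ 1 ≤ w ∧ (1 ≤ k → 1 ≤ q + r) ∧ ∃ c : ℝ,
        t = c * (p * s + q * (1 - s)) ∧ 1 - t = c * (r * s + w * (1 - s)) := by
  induction k generalizing t with
  | zero => exact ⟨t, rfl, 1, 0, 0, 1, le_rfl, le_rfl, by simp, 1, by simp, by simp⟩
  | succ k ih =>
    obtain ⟨u, hu0, hu1, hTu, m, n, hmn, c, hc, hc'⟩ := exists_RomikT_circlePoint_eq h0 h1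
    obtain ⟨s, hTs, p, q, r, w, hp, hw, -, d, hd, hd'⟩ := ih hu0 hu1
    refine ⟨s, by rw [Function.iterate_succ_apply, hTu, hTs],
      p + m * r, q + m * w, n * p + r, n * q + w, by nlinarith, by nlinarith,
      fun _ ↦ by nlinarith, c * d, ?_, ?_⟩
    · rw [hc, hd', hd]
      push_cast
      ring
    · rw [hc', hd', hd]
      push_cast
      ring

/-- The subfield `ℚ(√D)` of the real numbers. -/
def sqrtSubfield (D : ℕ) : Subfield ℝ where
  carrier := {x | ∃ a b : ℚ, x = a + b * √(D : ℝ)}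
  one_mem' := ⟨1, 0, by simp⟩
  zero_mem' := ⟨0, 0, by simp⟩
  add_mem' := by
    rintro _ _ ⟨a, b, rfl⟩ ⟨c, d, rfl⟩
    exact ⟨a + c, b + d, by push_cast; ring⟩
  neg_mem' := by
    rintro _ ⟨a, b, rfl⟩
    exact ⟨-a, -b, by push_cast; ring⟩
  mul_mem' := by
    rintro _ _ ⟨a, b, rfl⟩ ⟨c, d, rfl⟩
    have h : √(D : ℝ) * √(D : ℝ) = D := Real.mul_self_sqrt (by positivity)
    exact ⟨a * c + b * d * D, a * d + b * c, by push_cast; linear_combination (b * d : ℝ) * h⟩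
  inv_mem' := by
    rintro _ ⟨a, b, rfl⟩
    have h : √(D : ℝ) * √(D : ℝ) = D := Real.mul_self_sqrt (by positivity)
    by_cases hx : (a + b * √(D : ℝ) : ℝ) = 0
    · exact ⟨0, 0, by simp [hx]⟩
    by_cases hy : (a - b * √(D : ℝ) : ℝ) = 0
    · refine ⟨(2 * a)⁻¹, 0, ?_⟩
      rw [show (a + b * √(D : ℝ) : ℝ) = 2 * a by linarith]
      simp
    · have hn : (a ^ 2 - b ^ 2 * D : ℝ) = (a + b * √(D : ℝ)) * (a - b * √(D : ℝ)) := by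
        linear_combination (b ^ 2 : ℝ) * h
      refine ⟨a / (a ^ 2 - b ^ 2 * D), -b / (a ^ 2 - b ^ 2 * D), ?_⟩
      push_cast
      rw [hn]
      field_simp
      ring

lemma mem_sqrtSubfield {D : ℕ} {x : ℝ} :
    x ∈ sqrtSubfield D ↔ ∃ a b : ℚ, x = a + b * √(D : ℝ) := Iff.rfl

lemma exists_sqrt_natCast_mem_sqrtSubfield (n : ℕ) :
    ∃ D, Squarefree D ∧ 2 ≤ D ∧ √(n : ℝ) ∈ sqrtSubfield D := by
  obtain ⟨D, m, rfl, hD⟩ := Nat.sq_mul_squarefree n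
  have hs : √((m ^ 2 * D : ℕ) : ℝ) = m * √(D : ℝ) := by
    push_cast
    rw [Real.sqrt_mul (by positivity), Real.sqrt_sq (by positivity)]
  rw [hs]
  rcases Nat.lt_or_ge D 2 with h | h
  · have hD1 : D = 1 := by
      have := hD.ne_zero
      omega
    exact ⟨2, Nat.squarefree_two, le_rfl, m, 0, by simp [hD1]⟩
  · exact ⟨D, hD, h, 0, m, by simp⟩

/-- A real root of a nonzero integer polynomial of degree at most two lies in a real quadratic
field. -/
lemma exists_mem_sqrtSubfield_of_quadratic {A B C : ℤ} {t : ℝ}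
    (h : A * t ^ 2 + B * t + C = 0) (hne : ¬(A = 0 ∧ B = 0 ∧ C = 0)) :
    ∃ D, Squarefree D ∧ 2 ≤ D ∧ t ∈ sqrtSubfield D := by
  by_cases hA : A = 0
  · subst hA
    by_cases hB : B = 0
    · subst hB
      exact absurd ⟨rfl, rfl, by simpa using h⟩ hne
    · have hB' : (B : ℝ) ≠ 0 := by exact_mod_cast hB
      refine ⟨2, Nat.squarefree_two, le_rfl, -C / B, 0, ?_⟩
      push_cast at h ⊢
      field_simp
      linarith
  · have hA' : (A : ℝ) ≠ 0 := by exact_mod_cast hA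
    have hsq : (2 * A * t + B) ^ 2 = ((B ^ 2 - 4 * A * C : ℤ) : ℝ) := by
      push_cast
      linear_combination (4 * A : ℝ) * h
    have hdisc : 0 ≤ B ^ 2 - 4 * A * C := by
      have : (0 : ℝ) ≤ ((B ^ 2 - 4 * A * C : ℤ) : ℝ) := hsq ▸ sq_nonneg _
      exact_mod_cast this
    obtain ⟨n, hn⟩ := Int.eq_ofNat_of_zero_le hdisc
    obtain ⟨D, hD, hD2, hmem⟩ := exists_sqrt_natCast_mem_sqrtSubfield n
    refine ⟨D, hD, hD2, ?_⟩
    rw [hn, Int.cast_natCast] at hsq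
    rw [← hsq, Real.sqrt_sq_eq_abs] at hmem
    have hlin : 2 * A * t + B ∈ sqrtSubfield D := by
      rcases abs_choice (2 * A * t + B) with h' | h' <;> rw [h'] at hmem
      · exact hmem
      · exact neg_mem_iff.1 hmem
    have ht : t = (2 * A * t + B - B) / ((2 * A : ℤ) : ℝ) := by
      push_cast
      field_simp
      ring
    rw [ht]
    exact div_mem (sub_mem hlin (intCast_mem _ _)) (intCast_mem _ _)

theorem stmt_15 (α β : ℝ) (hα : 0 ≤ α) (hβ : 0 ≤ β) (hcirc : α ^ 2 + β ^ 2 = 1)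
    (hne1 : (α, β) ≠ (1, 0)) (hne2 : (α, β) ≠ (0, 1))
    (k : ℕ) (hk : 1 ≤ k) (hper : RomikT^[k] (α, β) = (α, β)) :
    ∃ D : ℤ, Squarefree D ∧ 2 ≤ D ∧
      ∃ a b c e : ℚ, α = (a : ℝ) + (b : ℝ) * Real.sqrt (D : ℝ) ∧
        β = (c : ℝ) + (e : ℝ) * Real.sqrt (D : ℝ) := by
  obtain ⟨t, h0, h1, hP⟩ := exists_eq_circlePoint hα hβ hcirc
  obtain ⟨s, hs, p, q, r, w, -, -, hqr, c, hc, hc'⟩ :=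
    exists_iterate_RomikT_circlePoint_eq k h0 h1
  obtain rfl : t = s := circlePoint_injective (by rw [← hs, ← hP, hper])
  have hquad : ((r - w + p - q : ℤ) : ℝ) * t ^ 2 + ((w - p + 2 * q : ℤ) : ℝ) * t
      + ((-q : ℤ) : ℝ) = 0 := by
    push_cast
    linear_combination (r * t + w * (1 - t)) * hc - (p * t + q * (1 - t)) * hc'
  obtain ⟨D, hD, hD2, ht⟩ := exists_mem_sqrtSubfield_of_quadratic hquad (by
    have := hqr hk
    omega)
  have hsq : t ^ 2 ∈ sqrtSubfield D := pow_mem ht 2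
  have hden : 1 + t ^ 2 ∈ sqrtSubfield D := add_mem (one_mem _) hsq
  obtain ⟨rfl, rfl⟩ := Prod.mk.inj hP
  obtain ⟨a, b, hab⟩ := mem_sqrtSubfield.1 (div_mem (sub_mem (one_mem _) hsq) hden)
  obtain ⟨c', e, hce⟩ := mem_sqrtSubfield.1
    (div_mem (mul_mem (ofNat_mem (sqrtSubfield D) 2) ht) hden)
  exact ⟨D, Int.squarefree_natCast.2 hD, by exact_mod_cast hD2, a, b, c', e,
    by simpa using hab, by simpa using hce⟩
end

section
/- Let P = (α, β) be a point of the closed unit quarter circle, and suppose there exist a squarefree integer D ≥ 2 and rationals a, b, c, e with α = a + b·√D and β = c + e·√D. Then the T-orbit of P is eventually periodic: there exist integers n ≥ 0 and k ≥ 1 such that T^{n+k}(P) = T^n(P). -/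
/-- An integer is bounded by its square. -/
theorem int_abs_le_sq (n : ℤ) : |n| ≤ n ^ 2 := by
  rw [← Int.natCast_natAbs, ← Int.natAbs_sq]
  exact_mod_cast Nat.le_self_pow two_ne_zero _

/-- Points of the closed quarter circle on some integral line `p x + q y = r` with
`p ^ 2 + q ^ 2 - r ^ 2 = N` and `|r| ≤ B`. -/
def quarterCircleLineSet (N B : ℤ) : Set (ℝ × ℝ) :=
  {P | 0 ≤ P.1 ∧ 0 ≤ P.2 ∧ P.1 ^ 2 + P.2 ^ 2 = 1 ∧
    ∃ p q r : ℤ, (p ≠ 0 ∨ q ≠ 0) ∧ (p : ℝ) * P.1 + q * P.2 = r ∧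
      p ^ 2 + q ^ 2 - r ^ 2 = N ∧ |r| ≤ B}

/-- A line meets the unit circle in finitely many points. -/
theorem finite_line_inter_circle {p q : ℝ} (r : ℝ) (h : p ≠ 0 ∨ q ≠ 0) :
    {P : ℝ × ℝ | P.1 ^ 2 + P.2 ^ 2 = 1 ∧ p * P.1 + q * P.2 = r}.Finite := by
  have hpos : p ^ 2 + q ^ 2 ≠ 0 := by
    rcases h with h | h <;> positivity
  refine Set.Finite.subset (Set.Finite.image
    (fun u : ℝ => ((p * r + q * u) / (p ^ 2 + q ^ 2), (q * r - p * u) / (p ^ 2 + q ^ 2)))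
    (Set.toFinite {√(p ^ 2 + q ^ 2 - r ^ 2), -√(p ^ 2 + q ^ 2 - r ^ 2)})) ?_
  rintro ⟨x, y⟩ ⟨hc, hl⟩
  dsimp only at hc hl
  refine ⟨q * x - p * y, ?_, ?_⟩
  · have hu : p ^ 2 + q ^ 2 - r ^ 2 = (q * x - p * y) ^ 2 := by
      rw [← hl]
      linear_combination (-(p ^ 2 + q ^ 2)) * hc
    rw [hu, Real.sqrt_sq_eq_abs]
    rcases abs_choice (q * x - p * y) with h' | h' <;> simp [h']
  · rw [← hl]
    ext
    · field_simp
      ring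
    · field_simp
      ring

theorem finite_quarterCircleLineSet (N B : ℤ) : (quarterCircleLineSet N B).Finite := by
  set C : ℤ := |N| + B ^ 2
  have hbox : {t : ℤ × ℤ × ℤ | t ∈ Set.Icc (-C) C ×ˢ Set.Icc (-C) C ×ˢ Set.Icc (-B) B ∧
      (t.1 ≠ 0 ∨ t.2.1 ≠ 0)}.Finite :=
    ((Set.finite_Icc _ _).prod ((Set.finite_Icc _ _).prod (Set.finite_Icc _ _))).subset
      fun _ ht => ht.1
  refine (hbox.biUnion (t := fun t => {P : ℝ × ℝ | P.1 ^ 2 + P.2 ^ 2 = 1 ∧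
    (t.1 : ℝ) * P.1 + (t.2.1 : ℝ) * P.2 = t.2.2}) fun t ht =>
      finite_line_inter_circle _ (by exact_mod_cast ht.2)).subset ?_
  rintro P ⟨-, -, hc, p, q, r, h0, hl, hN, hr⟩
  have hr2 : r ^ 2 ≤ B ^ 2 := sq_le_sq' (neg_le_of_abs_le hr) (le_of_abs_le hr)
  have hNa := le_abs_self N
  have hp : |p| ≤ C := by
    have := int_abs_le_sq p
    simp only [C]
    nlinarith [sq_nonneg q]
  have hq : |q| ≤ C := by
    have := int_abs_le_sq q
    simp only [C]
    nlinarith [sq_nonneg p]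
  exact Set.mem_biUnion (x := (p, q, r))
    ⟨⟨abs_le.1 hp, abs_le.1 hq, abs_le.1 hr⟩, h0⟩ ⟨hc, hl⟩

/-- If `(1, 0)` and `(0, 1)` lie strictly on different sides of an integral line, its coefficients
are bounded by the discriminant. -/
theorem abs_le_of_separates {p q r : ℤ} (h : (p - r) * (q - r) < 0) :
    |p| ≤ p ^ 2 + q ^ 2 - r ^ 2 ∧ |q| ≤ p ^ 2 + q ^ 2 - r ^ 2 ∧ |r| ≤ p ^ 2 + q ^ 2 - r ^ 2 := by
  wlog hpq : q < p generalizing p q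
  · have hne : p ≠ q := by
      rintro rfl
      nlinarith [mul_self_nonneg (p - r)]
    have := this (p := q) (q := p) (by linarith) (by omega)
    rw [add_comm (p ^ 2)]
    exact ⟨this.2.1, this.1, this.2.2⟩
  have hp : r < p := by
    by_contra! hp
    nlinarith
  have hq : q < r := by
    by_contra! hq
    nlinarith
  have hp2 := int_abs_le_sq p
  have hq2 := int_abs_le_sq q
  rcases le_or_gt 0 r with hr | hr
  · have : p + r ≤ p ^ 2 - r ^ 2 := by nlinarith
    rw [abs_of_nonneg hr, abs_of_nonneg (hr.trans hp.le)] at *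
    have := abs_nonneg q
    refine ⟨?_, ?_, ?_⟩ <;> linarith
  · have : -q - r ≤ q ^ 2 - r ^ 2 := by nlinarith
    rw [abs_of_neg hr, abs_of_neg (hq.trans hr)] at *
    have := abs_nonneg p
    refine ⟨?_, ?_, ?_⟩ <;> linarith

/-- If `(1, 0)` and `(0, 1)` lie on the same side of a line meeting the open quarter circle,
reflection does not increase the constant coefficient of that line. -/
theorem abs_reflect_le {p q r x y : ℝ} (hx : 0 < x) (hy : 0 < y) (hc : x ^ 2 + y ^ 2 = 1)
    (hl : p * x + q * y = r) (h : 0 ≤ (p - r) * (q - r)) :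
    |3 * r - 2 * p - 2 * q| ≤ |r| := by
  wlog hpr : r ≤ p ∧ r ≤ q generalizing p q r
  · have hneg : p ≤ r ∧ q ≤ r := by
      rcases mul_nonneg_iff.1 h with h | h
      · exact absurd ⟨by linarith, by linarith⟩ hpr
      · exact ⟨by linarith, by linarith⟩
    have := this (p := -p) (q := -q) (r := -r) (by linarith) (by linarith)
      ⟨by linarith, by linarith⟩
    rw [abs_neg] at this
    rw [← abs_neg]
    convert this using 2
    ring
  obtain ⟨hp, hq⟩ := hpr
  have hx1 : x < 1 := by nlinarith
  have hy1 : y < 1 := by nlinarith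
  have hxy : 1 < x + y := by nlinarith
  have hr : r ≤ 0 := by
    by_contra! hr
    nlinarith
  have hp0 : p ≤ 0 := by
    by_contra! hp0
    nlinarith [mul_pos hp0 hx]
  have hq0 : q ≤ 0 := by
    by_contra! hq0
    nlinarith [mul_pos hq0 hy]
  have hs : p + q ≤ r := by nlinarith
  rw [abs_of_nonpos hr, abs_le]
  constructor <;> linarith

theorem mapsTo_RomikT {N B : ℤ} (hNB : 7 * N ≤ B) :
    Set.MapsTo RomikT (quarterCircleLineSet N B) (quarterCircleLineSet N B) := by
  rintro ⟨x, y⟩ ⟨hx, hy, hc, p, q, r, h0, hl, hN, hr⟩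
  dsimp only at hx hy hc hl
  rcases hx.eq_or_lt with rfl | hx
  · obtain rfl : y = 1 := by nlinarith
    have : RomikT (0, 1) = (0, 1) := by norm_num [RomikT]
    rw [this]
    exact ⟨hx, hy, hc, p, q, r, h0, hl, hN, hr⟩
  rcases hy.eq_or_lt with rfl | hy
  · obtain rfl : x = 1 := by nlinarith
    have : RomikT (1, 0) = (1, 0) := by norm_num [RomikT]
    rw [this]
    exact ⟨hx.le, hy, hc, p, q, r, h0, hl, hN, hr⟩
  have hden : 0 < 3 - 2 * x - 2 * y := by nlinarith [sq_nonneg (x - y)]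
  have hr' : |3 * r - 2 * p - 2 * q| ≤ B := by
    rcases lt_or_ge ((p - r) * (q - r)) 0 with h | h
    · obtain ⟨h1, h2, h3⟩ := abs_le_of_separates h
      rw [hN, abs_le] at h1 h2 h3
      rw [abs_le]
      constructor <;> linarith
    · refine le_trans ?_ hr
      exact_mod_cast abs_reflect_le hx hy hc hl (by exact_mod_cast h)
  have hsign (z : ℝ) : ∃ s : ℤ, s ^ 2 = 1 ∧ |z| = s * z := by
    rcases abs_choice z with h | h
    · exact ⟨1, by norm_num, by simpa using h⟩
    · exact ⟨-1, by norm_num, by simpa using h⟩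
  obtain ⟨s, hs, hsx⟩ := hsign (2 - x - 2 * y)
  obtain ⟨t, ht, hty⟩ := hsign (2 - 2 * x - y)
  have hs' : (s : ℝ) ^ 2 = 1 := by exact_mod_cast hs
  have ht' : (t : ℝ) ^ 2 = 1 := by exact_mod_cast ht
  have hs0 : s ≠ 0 := by
    rintro rfl
    norm_num at hs
  have ht0 : t ≠ 0 := by
    rintro rfl
    norm_num at ht
  have hline : (((s * (2 * r - p - 2 * q) : ℤ)) : ℝ) * (RomikT (x, y)).1 +
      ((t * (2 * r - 2 * p - q) : ℤ) : ℝ) * (RomikT (x, y)).2 =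
        ((3 * r - 2 * p - 2 * q : ℤ) : ℝ) := by
    simp only [RomikT, hsx, hty]
    push_cast
    field_simp
    linear_combination ((2 * r - p - 2 * q : ℝ) * (2 - x - 2 * y)) * hs' +
      ((2 * r - 2 * p - q : ℝ) * (2 - 2 * x - y)) * ht' + hl
  refine ⟨div_nonneg (abs_nonneg _) hden.le, div_nonneg (abs_nonneg _) hden.le, ?_,
    s * (2 * r - p - 2 * q), t * (2 * r - 2 * p - q), 3 * r - 2 * p - 2 * q, ?_, hline, ?_, hr'⟩
  · simp only [RomikT, div_pow, sq_abs]
    field_simp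
    linear_combination hc
  · by_contra! h
    have h1 : 2 * r - p - 2 * q = 0 := by simpa [hs0] using h.1
    have h2 : 2 * r - 2 * p - q = 0 := by simpa [ht0] using h.2
    rw [h.1, h.2] at hline
    have h3 : 3 * r - 2 * p - 2 * q = 0 := by
      have : ((3 * r - 2 * p - 2 * q : ℤ) : ℝ) = 0 := by
        rw [← hline]
        simp
      exact_mod_cast this
    omega
  · linear_combination (2 * r - p - 2 * q) ^ 2 * hs + (2 * r - 2 * p - q) ^ 2 * ht + hN

/-- A self-map of a finite set has eventually periodic orbits. -/
theorem exists_iterate_add_eq_of_mapsTo {X : Type*} {f : X → X} {S : Set X} (hS : S.Finite)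
    (hf : Set.MapsTo f S S) {x : X} (hx : x ∈ S) :
    ∃ n k : ℕ, 1 ≤ k ∧ f^[n + k] x = f^[n] x := by
  obtain ⟨m, -, n, -, hmn, h⟩ := Set.infinite_univ.exists_lt_map_eq_of_mapsTo
    (f := fun n : ℕ => f^[n] x) (fun n _ => hf.iterate n hx) hS
  exact ⟨m, n - m, by omega, by simpa [Nat.add_sub_cancel' hmn.le] using h.symm⟩

/-- A point with a rational linear relation has an integral one. -/
theorem exists_int_line {x y : ℝ} {p q r : ℚ} (h0 : p ≠ 0 ∨ q ≠ 0)
    (hl : (p : ℝ) * x + q * y = r) :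
    ∃ p' q' r' : ℤ, (p' ≠ 0 ∨ q' ≠ 0) ∧ (p' : ℝ) * x + q' * y = r' := by
  have key (u : ℚ) : (u.num : ℝ) = u * u.den := by exact_mod_cast (Rat.mul_den_eq_num u).symm
  refine ⟨p.num * q.den * r.den, q.num * p.den * r.den, r.num * p.den * q.den, ?_, ?_⟩
  · simpa using h0
  · push_cast
    rw [key p, key q, key r]
    linear_combination ((p.den : ℝ) * q.den * r.den) * hl

theorem stmt_16 (α β : ℝ) (hα : 0 ≤ α) (hβ : 0 ≤ β) (hcirc : α ^ 2 + β ^ 2 = 1)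
    (D : ℤ) (hD : Squarefree D) (hD2 : 2 ≤ D)
    (a b c e : ℚ) (ha : α = (a : ℝ) + (b : ℝ) * Real.sqrt (D : ℝ))
    (hb : β = (c : ℝ) + (e : ℝ) * Real.sqrt (D : ℝ)) :
    ∃ n k : ℕ, 1 ≤ k ∧ RomikT^[n + k] (α, β) = RomikT^[n] (α, β) := by
  obtain ⟨p, q, r, h0, hl⟩ : ∃ p q r : ℤ, (p ≠ 0 ∨ q ≠ 0) ∧ (p : ℝ) * α + q * β = r := by
    by_cases h : e = 0 ∧ b = 0
    · refine exists_int_line (p := 1) (q := 0) (r := a) (by simp) ?_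
      simp [ha, h.2]
    · refine exists_int_line (p := e) (q := -b) (r := e * a - b * c)
        (by rw [neg_ne_zero]; tauto) ?_
      rw [ha, hb]
      push_cast
      ring
  exact exists_iterate_add_eq_of_mapsTo (finite_quarterCircleLineSet _ _)
    (mapsTo_RomikT (le_max_left (7 * (p ^ 2 + q ^ 2 - r ^ 2)) |r|))
    ⟨hα, hβ, hcirc, p, q, r, h0, hl, rfl, le_max_right _ _⟩
end

section
/- (Lagrange's theorem for the Romik system) Let P = (α, β) be a point of the closed unit quarter circle. Then the T-orbit of P is eventually periodic (there exist integers n ≥ 0 and k ≥ 1 with T^{n+k}(P) = T^n(P)) if and only if there exists a squarefree positive integer D such that α and β lie in ℚ(√D), i.e. there exist rationals a, b, c, e with α = a + b·√D and β = c + e·√D. -/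
namespace Romik

/-- The Romik map in the stereographic coordinate `t = y / (1 + x)`. -/
noncomputable def slopeMap (t : ℝ) : ℝ :=
  if t ≤ 1 / 3 then t / (1 - 2 * t) else if t ≤ 1 / 2 then 1 / t - 2 else 2 - 1 / t

/-- The stereographic parametrization of the unit circle. -/
noncomputable def circlePoint (t : ℝ) : ℝ × ℝ :=
  ((1 - t ^ 2) / (1 + t ^ 2), 2 * t / (1 + t ^ 2))

lemma slopeMap_cases (t : ℝ) :
    (t ≤ 1 / 3 ∧ slopeMap t = t / (1 - 2 * t)) ∨
    (1 / 3 < t ∧ t ≤ 1 / 2 ∧ slopeMap t = 1 / t - 2) ∨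
    (1 / 2 < t ∧ slopeMap t = 2 - 1 / t) := by
  unfold slopeMap
  split_ifs with h1 h2
  · exact Or.inl ⟨h1, rfl⟩
  · exact Or.inr (Or.inl ⟨not_le.mp h1, h2, rfl⟩)
  · exact Or.inr (Or.inr ⟨not_le.mp h2, rfl⟩)

lemma slopeMap_mem {t : ℝ} (ht : t ∈ Set.Icc (0 : ℝ) 1) : slopeMap t ∈ Set.Icc (0 : ℝ) 1 := by
  obtain ⟨h0, h1⟩ := ht
  rcases slopeMap_cases t with ⟨h, hs⟩ | ⟨h, h', hs⟩ | ⟨h, hs⟩ <;> rw [hs]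
  · have : 0 < 1 - 2 * t := by linarith
    exact ⟨by positivity, by rw [div_le_one this]; linarith⟩
  · have h0 : 0 < t := by linarith
    have e : 1 / t - 2 = (1 - 2 * t) / t := by field_simp
    rw [e]
    exact ⟨div_nonneg (by linarith) h0.le, by rw [div_le_one h0]; linarith⟩
  · have h0 : 0 < t := by linarith
    have e : 2 - 1 / t = (2 * t - 1) / t := by field_simp
    rw [e]
    exact ⟨div_nonneg (by linarith) h0.le, by rw [div_le_one h0]; linarith⟩

lemma iterate_slopeMap_mem {t : ℝ} (ht : t ∈ Set.Icc (0 : ℝ) 1) (n : ℕ) :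
    slopeMap^[n] t ∈ Set.Icc (0 : ℝ) 1 := by
  induction n with
  | zero => exact ht
  | succ n ih => rw [Function.iterate_succ_apply']; exact slopeMap_mem ih

lemma romikT_circlePoint {t : ℝ} (ht : t ∈ Set.Icc (0 : ℝ) 1) :
    RomikT (circlePoint t) = circlePoint (slopeMap t) := by
  have hpos : 0 < 1 + t ^ 2 := by positivity
  have hN : 0 < (1 - 2 * t) ^ 2 + t ^ 2 := by nlinarith [sq_nonneg (5 * t - 2)]
  have e0 : 3 - 2 * ((1 - t ^ 2) / (1 + t ^ 2)) - 2 * (2 * t / (1 + t ^ 2)) =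
      ((1 - 2 * t) ^ 2 + t ^ 2) / (1 + t ^ 2) := by field_simp; ring
  have e1 : 2 - (1 - t ^ 2) / (1 + t ^ 2) - 2 * (2 * t / (1 + t ^ 2)) =
      ((1 - t) * (1 - 3 * t)) / (1 + t ^ 2) := by field_simp; ring
  have e2 : 2 - 2 * ((1 - t ^ 2) / (1 + t ^ 2)) - 2 * t / (1 + t ^ 2) =
      (2 * t * (2 * t - 1)) / (1 + t ^ 2) := by field_simp; ring
  obtain ⟨h0, h1⟩ := ht
  unfold RomikT circlePoint
  simp only [e0, e1, e2, abs_div, abs_of_pos hpos, div_div_div_cancel_right₀ hpos.ne']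
  rcases slopeMap_cases t with ⟨h, hs⟩ | ⟨h, h', hs⟩ | ⟨h, hs⟩ <;> rw [hs]
  · have hd : 1 - 2 * t ≠ 0 := by linarith
    rw [abs_of_nonneg (by nlinarith), abs_of_nonpos (by nlinarith)]
    have hd2 := pow_ne_zero 2 hd
    have e3 : 1 + (t / (1 - 2 * t)) ^ 2 = ((1 - 2 * t) ^ 2 + t ^ 2) / (1 - 2 * t) ^ 2 := by
      rw [div_pow, add_div, div_self hd2]
    have e4 : 1 - (t / (1 - 2 * t)) ^ 2 = ((1 - t) * (1 - 3 * t)) / (1 - 2 * t) ^ 2 := by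
      rw [div_pow, eq_div_iff hd2, sub_mul, div_mul_cancel₀ _ hd2]; ring
    have e5 : 2 * (t / (1 - 2 * t)) = -(2 * t * (2 * t - 1)) / (1 - 2 * t) ^ 2 := by
      rw [← mul_div_assoc, div_eq_div_iff hd hd2]; ring
    rw [e3, e4, e5, div_div_div_cancel_right₀ hd2, div_div_div_cancel_right₀ hd2]
  · have hd : t ≠ 0 := by linarith
    rw [abs_of_nonpos (by nlinarith), abs_of_nonpos (by nlinarith)]
    have : 1 + (1 / t - 2) ^ 2 ≠ 0 := by positivity
    congr 1 <;> · rw [div_eq_div_iff hN.ne' this]; field_simp; ring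
  · have hd : t ≠ 0 := by linarith
    rw [abs_of_nonpos (by nlinarith), abs_of_nonneg (by nlinarith)]
    have : 1 + (2 - 1 / t) ^ 2 ≠ 0 := by positivity
    congr 1 <;> · rw [div_eq_div_iff hN.ne' this]; field_simp; ring

lemma iterate_romikT_circlePoint {t : ℝ} (ht : t ∈ Set.Icc (0 : ℝ) 1) (n : ℕ) :
    RomikT^[n] (circlePoint t) = circlePoint (slopeMap^[n] t) := by
  induction n with
  | zero => rfl
  | succ n ih =>
    rw [Function.iterate_succ_apply', ih, romikT_circlePoint (iterate_slopeMap_mem ht n),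
      Function.iterate_succ_apply']

lemma circlePoint_injective : Function.Injective circlePoint := by
  have key (t : ℝ) : (circlePoint t).2 / (1 + (circlePoint t).1) = t := by
    have : 1 + t ^ 2 ≠ 0 := by positivity
    have e : 1 + (1 - t ^ 2) / (1 + t ^ 2) = 2 / (1 + t ^ 2) := by field_simp; ring
    simp only [circlePoint, e]
    field_simp
  intro s t h
  rw [← key s, h, key t]

/-- The subfield `ℚ(√D)` of `ℝ`, given by its explicit elements. -/
noncomputable def quadField (D : ℤ) (hD : 0 < D) : Subfield ℝ where
  carrier := {x | ∃ a b : ℚ, x = (a : ℝ) + (b : ℝ) * Real.sqrt (D : ℝ)}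
  zero_mem' := ⟨0, 0, by simp⟩
  one_mem' := ⟨1, 0, by simp⟩
  add_mem' := by
    rintro _ _ ⟨a, b, rfl⟩ ⟨c, d, rfl⟩
    exact ⟨a + c, b + d, by push_cast; ring⟩
  neg_mem' := by
    rintro _ ⟨a, b, rfl⟩
    exact ⟨-a, -b, by push_cast; ring⟩
  mul_mem' := by
    rintro _ _ ⟨a, b, rfl⟩ ⟨c, d, rfl⟩
    have hs : Real.sqrt (D : ℝ) ^ 2 = D := Real.sq_sqrt (by exact_mod_cast hD.le)
    exact ⟨a * c + b * d * D, a * d + b * c, by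
      push_cast; linear_combination (b : ℝ) * d * hs⟩
  inv_mem' := by
    rintro _ ⟨a, b, rfl⟩
    have hs : Real.sqrt (D : ℝ) ^ 2 = D := Real.sq_sqrt (by exact_mod_cast hD.le)
    by_cases h0 : (a : ℝ) + (b : ℝ) * Real.sqrt (D : ℝ) = 0
    · exact ⟨0, 0, by simp [h0]⟩
    by_cases h1 : (a : ℝ) - (b : ℝ) * Real.sqrt (D : ℝ) = 0
    · refine ⟨(2 * a)⁻¹, 0, ?_⟩
      have : (a : ℝ) + (b : ℝ) * Real.sqrt (D : ℝ) = 2 * a := by linarith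
      rw [this]
      push_cast
      ring
    · have hn : (a : ℝ) ^ 2 - b ^ 2 * D ≠ 0 := by
        rw [← hs]
        convert mul_ne_zero h0 h1 using 1
        ring
      refine ⟨a / (a ^ 2 - b ^ 2 * D), -b / (a ^ 2 - b ^ 2 * D), ?_⟩
      push_cast
      rw [inv_eq_iff_eq_inv, eq_comm, inv_eq_iff_eq_inv, ← one_div, eq_div_iff h0]
      field_simp
      linear_combination -(b : ℝ) ^ 2 * hs

/-- A real root of a nonzero integer polynomial of degree at most two lies in some `ℚ(√D)`. -/
lemma exists_mem_quadField_of_root {A B C : ℤ} {s : ℝ} (h : (A : ℝ) * s ^ 2 + B * s + C = 0)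
    (hne : ¬(A = 0 ∧ B = 0 ∧ C = 0)) :
    ∃ (D : ℤ) (hD : 0 < D), Squarefree D ∧ s ∈ quadField D hD := by
  by_cases hA : A = 0
  · refine ⟨1, one_pos, squarefree_one, -C / B, 0, ?_⟩
    subst hA
    have hB : (B : ℝ) ≠ 0 := by
      rintro hB
      apply hne
      have hB' : B = 0 := by exact_mod_cast hB
      refine ⟨rfl, hB', ?_⟩
      simpa [hB'] using h
    push_cast at h ⊢
    field_simp
    linarith
  have hA' : (A : ℝ) ≠ 0 := by exact_mod_cast hA
  have hdisc : (2 * A * s + B : ℝ) ^ 2 = ((B ^ 2 - 4 * A * C : ℤ) : ℝ) := by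
    push_cast; linear_combination 4 * (A : ℝ) * h
  have hnn : 0 ≤ B ^ 2 - 4 * A * C := by
    have : (0 : ℝ) ≤ ((B ^ 2 - 4 * A * C : ℤ) : ℝ) := hdisc ▸ sq_nonneg _
    exact_mod_cast this
  obtain ⟨d, m, hdm, hsq⟩ := Nat.sq_mul_squarefree (B ^ 2 - 4 * A * C).toNat
  have hd : 0 < (d : ℤ) := by exact_mod_cast Nat.pos_of_ne_zero hsq.ne_zero
  refine ⟨d, hd, Int.squarefree_natCast.mpr hsq, ?_⟩
  have hdm' : ((B ^ 2 - 4 * A * C : ℤ) : ℝ) = (m * Real.sqrt ((d : ℤ) : ℝ)) ^ 2 := by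
    rw [mul_pow, Real.sq_sqrt (by positivity), ← Int.toNat_of_nonneg hnn, ← hdm]
    push_cast
    rfl
  rw [hdm'] at hdisc
  rcases sq_eq_sq_iff_eq_or_eq_neg.mp hdisc with e | e
  · refine ⟨-B / (2 * A), m / (2 * A), ?_⟩
    push_cast at e ⊢
    field_simp
    linarith
  · refine ⟨-B / (2 * A), -m / (2 * A), ?_⟩
    push_cast at e ⊢
    field_simp
    linarith

/-- `t` is the image of `s` under the integral Möbius map `x ↦ (p x + q) / (r x + u)`, which maps
the unit interval into itself. -/
structure IsMoebiusImage (p q r u : ℤ) (s t : ℝ) : Prop where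
  eq : t * (r * s + u) = p * s + q
  den_zero : 0 < u
  den_one : 0 < r + u
  num_zero : 0 ≤ q
  num_zero_le : q ≤ u
  num_one : 0 ≤ p + q
  num_one_le : p + q ≤ r + u

/-- Prepending one branch of `slopeMap` to a Möbius map gives one that cannot fix both endpoints. -/
lemma IsMoebiusImage.of_slopeMap {p q r u : ℤ} {s t : ℝ}
    (h : IsMoebiusImage p q r u s (slopeMap t)) :
    ∃ p' q' r' u' : ℤ, IsMoebiusImage p' q' r' u' s t ∧ ¬(q' = 0 ∧ p' + q' = r' + u') := by
  obtain ⟨e, h1, h2, h3, h4, h5, h6⟩ := h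
  rcases slopeMap_cases t with ⟨h, hs⟩ | ⟨h, h', hs⟩ | ⟨h, hs⟩ <;> rw [hs] at e
  · have hd : 1 - 2 * t ≠ 0 := by linarith
    refine ⟨p, q, r + 2 * p, u + 2 * q, ⟨?_, ?_, ?_, ?_, ?_, ?_, ?_⟩, ?_⟩ <;> try omega
    rw [div_mul_eq_mul_div, div_eq_iff hd] at e
    push_cast
    linarith
  · have hd : t ≠ 0 := by linarith
    refine ⟨r, u, p + 2 * r, q + 2 * u, ⟨?_, ?_, ?_, ?_, ?_, ?_, ?_⟩, ?_⟩ <;> try omega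
    field_simp at e
    push_cast
    linarith
  · have hd : t ≠ 0 := by linarith
    refine ⟨r, u, 2 * r - p, 2 * u - q, ⟨?_, ?_, ?_, ?_, ?_, ?_, ?_⟩, ?_⟩ <;> try omega
    field_simp at e
    push_cast
    linarith

lemma exists_isMoebiusImage (t : ℝ) (n : ℕ) :
    ∃ p q r u : ℤ, IsMoebiusImage p q r u (slopeMap^[n] t) t := by
  induction n generalizing t with
  | zero => exact ⟨1, 0, 0, 1, by constructor <;> simp⟩
  | succ n ih =>
    obtain ⟨p, q, r, u, h⟩ := ih (slopeMap t)
    obtain ⟨p₁, q₁, r₁, u₁, hcomp, -⟩ := h.of_slopeMap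
    exact ⟨p₁, q₁, r₁, u₁, hcomp⟩

/-- Periodic points of `slopeMap` are at most quadratic over `ℚ`. -/
lemma exists_mem_quadField_of_periodic {t : ℝ} {k : ℕ}
    (hk : 1 ≤ k) (h : slopeMap^[k] t = t) :
    ∃ (D : ℤ) (hD : 0 < D), Squarefree D ∧ t ∈ quadField D hD := by
  obtain ⟨k, rfl⟩ := Nat.exists_eq_add_of_le' hk
  obtain ⟨p, q, r, u, hm⟩ := exists_isMoebiusImage (slopeMap t) k
  rw [← Function.iterate_succ_apply, h] at hm
  obtain ⟨p', q', r', u', h', hne⟩ := hm.of_slopeMap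
  refine exists_mem_quadField_of_root (A := r') (B := u' - p') (C := -q') ?_ (by omega)
  push_cast
  linear_combination h'.eq

lemma exists_mem_quadField_of_eventually_periodic {t : ℝ} (ht : t ∈ Set.Icc (0 : ℝ) 1)
    {n k : ℕ} (hk : 1 ≤ k) (h : slopeMap^[n + k] t = slopeMap^[n] t) :
    ∃ (D : ℤ) (hD : 0 < D), Squarefree D ∧ t ∈ quadField D hD := by
  have hmem := iterate_slopeMap_mem ht n
  rw [add_comm, Function.iterate_add_apply] at h
  obtain ⟨D, hD, hsq, hs⟩ := exists_mem_quadField_of_periodic hk h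
  refine ⟨D, hD, hsq, ?_⟩
  obtain ⟨p, q, r, u, hm⟩ := exists_isMoebiusImage t n
  have h1 : (0 : ℝ) < u := by exact_mod_cast hm.den_zero
  have h2 : (0 : ℝ) < r + u := by exact_mod_cast hm.den_one
  have hpos : 0 < (r : ℝ) * slopeMap^[n] t + u := by
    obtain ⟨h3, h4⟩ := hmem
    rcases le_or_gt 0 (r : ℝ) with hr | hr
    · positivity
    · nlinarith
  rw [eq_div_of_mul_eq hpos.ne' hm.eq]
  exact div_mem (add_mem (mul_mem (intCast_mem _ _) hs) (intCast_mem _ _))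
    (add_mem (mul_mem (intCast_mem _ _) hs) (intCast_mem _ _))

lemma eventually_periodic_of_finite {X : Type*} {f : X → X} {x : X} {F : Set X} (hF : F.Finite)
    (n : ℕ) (h : ∀ m, f^[m + n] x ∈ F) : ∃ n k : ℕ, 1 ≤ k ∧ f^[n + k] x = f^[n] x := by
  have := hF.to_subtype
  obtain ⟨i, j, hij, he⟩ :=
    Finite.exists_ne_map_eq_of_infinite (fun m : ℕ => (⟨f^[m + n] x, h m⟩ : F))
  have he : f^[i + n] x = f^[j + n] x := congrArg Subtype.val he
  rcases lt_or_gt_of_ne hij with hlt | hlt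
  · exact ⟨i + n, j - i, by omega, by
      rw [he, show i + n + (j - i) = j + n by omega]⟩
  · exact ⟨j + n, i - j, by omega, by
      rw [← he, show j + n + (i - j) = i + n by omega]⟩

/-- The fractions in the unit interval with denominator at most `N`. -/
def boundedFractions (N : ℤ) : Set ℝ := {t | ∃ p q : ℤ, 0 ≤ p ∧ p ≤ q ∧ 0 < q ∧ q ≤ N ∧ t = p / q}

lemma finite_boundedFractions (N : ℤ) : (boundedFractions N).Finite := by
  refine (((Set.finite_Icc 0 N).prod (Set.finite_Icc 0 N)).image
    fun x : ℤ × ℤ => (x.1 / x.2 : ℝ)).subset ?_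
  rintro t ⟨p, q, h1, h2, h3, h4, rfl⟩
  exact ⟨(p, q), ⟨⟨h1, h2.trans h4⟩, ⟨h3.le, h4⟩⟩, rfl⟩

lemma slopeMap_mem_boundedFractions {N : ℤ} {t : ℝ} (h : t ∈ boundedFractions N) :
    slopeMap t ∈ boundedFractions N := by
  obtain ⟨p, q, h1, h2, h3, h4, rfl⟩ := h
  have hq : (0 : ℝ) < q := by exact_mod_cast h3
  rcases slopeMap_cases (p / q) with ⟨h, hs⟩ | ⟨h, h', hs⟩ | ⟨h, hs⟩ <;> rw [hs]
  · rw [div_le_div_iff₀ hq (by norm_num)] at h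
    have h : p * 3 ≤ 1 * q := by exact_mod_cast h
    refine ⟨p, q - 2 * p, by omega, by omega, by omega, by omega, ?_⟩
    have : (q - 2 * p : ℝ) ≠ 0 := by
      have : q - 2 * p ≠ 0 := by omega
      exact_mod_cast this
    have h'' : (1 - 2 * (p / q) : ℝ) = (q - 2 * p) / q := by field_simp
    rw [h'']
    push_cast
    field_simp
  · rw [div_lt_div_iff₀ (by norm_num) hq] at h
    rw [div_le_div_iff₀ hq (by norm_num)] at h'
    have h : 1 * q < p * 3 := by exact_mod_cast h
    have h' : p * 2 ≤ 1 * q := by exact_mod_cast h'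
    have hp : (p : ℝ) ≠ 0 := by
      have : p ≠ 0 := by omega
      exact_mod_cast this
    refine ⟨q - 2 * p, p, by omega, by omega, by omega, by omega, ?_⟩
    push_cast
    field_simp
  · rw [div_lt_div_iff₀ (by norm_num) hq] at h
    have h : 1 * q < p * 2 := by exact_mod_cast h
    have hp : (p : ℝ) ≠ 0 := by
      have : p ≠ 0 := by omega
      exact_mod_cast this
    refine ⟨2 * p - q, p, by omega, by omega, by omega, by omega, ?_⟩
    push_cast
    field_simp

lemma eventually_periodic_of_rational {t : ℚ} (ht : (t : ℝ) ∈ Set.Icc (0 : ℝ) 1) :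
    ∃ n k : ℕ, 1 ≤ k ∧ slopeMap^[n + k] (t : ℝ) = slopeMap^[n] (t : ℝ) := by
  refine eventually_periodic_of_finite (finite_boundedFractions t.den) 0 fun m => ?_
  induction m with
  | zero =>
    have h0 : 0 ≤ t := by exact_mod_cast ht.1
    have h1 : t ≤ 1 := by exact_mod_cast ht.2
    refine ⟨t.num, t.den, Rat.num_nonneg.mpr h0, ?_, by exact_mod_cast t.den_pos, le_rfl, ?_⟩
    · rw [← Rat.num_div_den t, div_le_one (by exact_mod_cast t.den_pos)] at h1
      exact_mod_cast h1
    · exact Rat.cast_def t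
  | succ m ih =>
    rw [add_right_comm, Function.iterate_succ_apply']
    exact slopeMap_mem_boundedFractions ih

/-- `t` is an irrational point of the unit interval, and `t`, `t'` are the roots of an integral
quadratic polynomial with leading coefficient `A` and discriminant `Δ`. -/
structure IsQuadPair (Δ A : ℤ) (t t' : ℝ) : Prop where
  irrational : Irrational t
  mem : t ∈ Set.Icc (0 : ℝ) 1
  lead_ne : A ≠ 0
  coeffs : ∃ B C : ℤ, (B : ℝ) = -A * (t + t') ∧ (C : ℝ) = A * (t * t') ∧ B ^ 2 - 4 * A * C = Δ

namespace IsQuadPair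

variable {Δ A : ℤ} {t t' : ℝ}

lemma irrational_conj (h : IsQuadPair Δ A t t') : Irrational t' := by
  obtain ⟨B, C, hB, -, -⟩ := h.coeffs
  have hA : (A : ℝ) ≠ 0 := by exact_mod_cast h.lead_ne
  rintro ⟨x, hx⟩
  refine h.irrational ⟨-B / A - x, ?_⟩
  push_cast
  rw [hB, hx]
  field_simp
  ring

lemma slopeMap_step (h : IsQuadPair Δ A t t') :
    ∃ (A' : ℤ) (s' : ℝ), IsQuadPair Δ A' (slopeMap t) s' ∧
      (t' ∉ Set.Icc (0 : ℝ) 1 → s' ∉ Set.Icc (0 : ℝ) 1) ∧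
      (t' ∈ Set.Icc (0 : ℝ) 1 → A'.natAbs < A.natAbs) := by
  have hirr' := h.irrational_conj
  obtain ⟨hirr, hmem, hA, B, C, hB, hC, hΔ⟩ := h
  have hA' : (A : ℝ) ≠ 0 := by exact_mod_cast hA
  have hApos : 0 < |(A : ℝ)| := abs_pos.mpr hA'
  have hne (x : ℝ) (hx : Irrational x) : x ≠ 0 ∧ x ≠ 1 ∧ 1 - 2 * x ≠ 0 := by
    refine ⟨hx.ne_zero, hx.ne_one, fun e => hx ⟨1 / 2, ?_⟩⟩
    push_cast
    linarith
  obtain ⟨ht0, ht1, ht2⟩ := hne t hirr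
  obtain ⟨ht0', ht1', ht2'⟩ := hne t' hirr'
  have hpos : 0 < t := lt_of_le_of_ne hmem.1 (Ne.symm ht0)
  have hlt : t < 1 := lt_of_le_of_ne hmem.2 ht1
  have decr (A' : ℤ) (x y : ℝ) (e : (A' : ℝ) = A * (x * y)) (hx : |x| < 1) (hy : |y| < 1) :
      A'.natAbs < A.natAbs := by
    rw [← Int.ofNat_lt, Int.natCast_natAbs, Int.natCast_natAbs]
    have : |(A' : ℝ)| < |(A : ℝ)| := by
      rw [e, abs_mul, abs_mul]
      exact mul_lt_of_lt_one_right hApos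
        (mul_lt_one_of_nonneg_of_lt_one_left (abs_nonneg x) hx hy.le)
    exact_mod_cast this
  have hsmem := slopeMap_mem hmem
  have outside (h : t' ∉ Set.Icc (0 : ℝ) 1) : t' < 0 ∨ 1 < t' := by
    by_contra! hc
    exact h hc
  have inside (h : t' ∈ Set.Icc (0 : ℝ) 1) : 0 < t' ∧ t' < 1 :=
    ⟨lt_of_le_of_ne h.1 (Ne.symm ht0'), lt_of_le_of_ne h.2 ht1'⟩
  rcases slopeMap_cases t with ⟨h, hs⟩ | ⟨h, h', hs⟩ | ⟨h, hs⟩ <;> rw [hs] at hsmem ⊢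
  · have e : ((A + 2 * B + 4 * C : ℤ) : ℝ) = A * ((1 - 2 * t) * (1 - 2 * t')) := by
      push_cast; rw [hB, hC]; ring
    refine ⟨A + 2 * B + 4 * C, t' / (1 - 2 * t'), ⟨?_, hsmem, ?_, B + 4 * C, C, ?_, ?_, ?_⟩,
      fun ho hi => ?_, fun hi => ?_⟩
    · rintro ⟨x, hx⟩
      have hx' : (x : ℝ) * (1 - 2 * t) = t := by rw [hx, div_mul_cancel₀ _ ht2]
      have hx0 : (1 + 2 * x : ℝ) ≠ 0 := by
        have : 0 ≤ (x : ℝ) := by rw [hx]; exact hsmem.1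
        positivity
      refine hirr ⟨x / (1 + 2 * x), ?_⟩
      push_cast
      rw [div_eq_iff hx0]
      linarith
    · intro e0
      rw [e0] at e
      exact mul_ne_zero hA' (mul_ne_zero ht2 ht2') (by simpa using e.symm)
    · rw [e, div_add_div _ _ ht2 ht2', ← mul_div_assoc, eq_div_iff (mul_ne_zero ht2 ht2')]
      push_cast
      rw [hB, hC]
      ring
    · rw [e, hC, div_mul_div_comm, mul_assoc, mul_div_cancel₀ _ (mul_ne_zero ht2 ht2')]
    · rw [← hΔ]; ring
    · rcases outside ho with h' | h'
      · exact absurd hi.1 (not_le.mpr (div_neg_of_neg_of_pos h' (by linarith)))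
      · exact absurd hi.1 (not_le.mpr (div_neg_of_pos_of_neg (by linarith) (by linarith)))
    · obtain ⟨h1, h2⟩ := inside hi
      exact decr _ _ _ e (abs_lt.mpr ⟨by linarith, by linarith⟩)
        (abs_lt.mpr ⟨by linarith, by linarith⟩)
  · refine ⟨C, 1 / t' - 2, ⟨?_, hsmem, ?_, B + 4 * C, A + 2 * B + 4 * C, ?_, ?_, ?_⟩,
      fun ho hi => ?_, fun hi => ?_⟩
    · rintro ⟨x, hx⟩
      refine hirr ⟨(x + 2)⁻¹, ?_⟩
      push_cast
      rw [hx]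
      field_simp
      ring
    · rintro rfl
      exact mul_ne_zero hA' (mul_ne_zero ht0 ht0') (by simpa using hC.symm)
    · push_cast; rw [hB, hC]; field_simp; ring
    · push_cast; rw [hB, hC]; field_simp; ring
    · rw [← hΔ]; ring
    · rcases outside ho with h' | h'
      · linarith [hi.1, one_div_neg.mpr h']
      · linarith [hi.1, (div_lt_one (by linarith : 0 < t')).mpr h']
    · obtain ⟨h1, h2⟩ := inside hi
      exact decr _ _ _ hC (abs_lt.mpr ⟨by linarith, by linarith⟩)
        (abs_lt.mpr ⟨by linarith, by linarith⟩)
  · refine ⟨C, 2 - 1 / t', ⟨?_, hsmem, ?_, -B - 4 * C, A + 2 * B + 4 * C, ?_, ?_, ?_⟩,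
      fun ho hi => ?_, fun hi => ?_⟩
    · rintro ⟨x, hx⟩
      refine hirr ⟨(2 - x)⁻¹, ?_⟩
      push_cast
      rw [hx]
      field_simp
      ring
    · rintro rfl
      exact mul_ne_zero hA' (mul_ne_zero ht0 ht0') (by simpa using hC.symm)
    · push_cast; rw [hB, hC]; field_simp; ring
    · push_cast; rw [hB, hC]; field_simp; ring
    · rw [← hΔ]; ring
    · rcases outside ho with h' | h'
      · linarith [hi.2, one_div_neg.mpr h']
      · linarith [hi.2, (div_lt_one (by linarith : 0 < t')).mpr h']
    · obtain ⟨h1, h2⟩ := inside hi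
      exact decr _ _ _ hC (abs_lt.mpr ⟨by linarith, by linarith⟩)
        (abs_lt.mpr ⟨by linarith, by linarith⟩)

/-- The orbit reaches a point whose conjugate lies outside the unit interval, by descent on the
leading coefficient. -/
lemma exists_iterate_reduced (h : IsQuadPair Δ A t t') :
    ∃ (n : ℕ) (A' : ℤ) (s' : ℝ), IsQuadPair Δ A' (slopeMap^[n] t) s' ∧
      s' ∉ Set.Icc (0 : ℝ) 1 := by
  induction hN : A.natAbs using Nat.strong_induction_on generalizing A t t' with
  | _ N ih =>
    by_cases ht' : t' ∈ Set.Icc (0 : ℝ) 1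
    · obtain ⟨A', s', hs, -, hlt⟩ := h.slopeMap_step
      obtain ⟨n, A'', s'', hn⟩ := ih _ (hN ▸ hlt ht') hs rfl
      exact ⟨n + 1, A'', s'', hn⟩
    · exact ⟨0, A, t', h, ht'⟩

lemma iterate_reduced (h : IsQuadPair Δ A t t') (ht' : t' ∉ Set.Icc (0 : ℝ) 1) (m : ℕ) :
    ∃ (A' : ℤ) (s' : ℝ), IsQuadPair Δ A' (slopeMap^[m] t) s' ∧ s' ∉ Set.Icc (0 : ℝ) 1 := by
  induction m with
  | zero => exact ⟨A, t', h, ht'⟩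
  | succ m ih =>
    obtain ⟨A', s', hs, ho⟩ := ih
    obtain ⟨A'', s'', hs', ho', -⟩ := hs.slopeMap_step
    rw [Function.iterate_succ_apply']
    exact ⟨A'', s'', hs', ho' ho⟩

end IsQuadPair

lemma finite_quadratic_roots {A : ℤ} (hA : A ≠ 0) (B C : ℤ) :
    {t : ℝ | (A : ℝ) * t ^ 2 + B * t + C = 0}.Finite := by
  have hA' : (A : ℝ) ≠ 0 := by exact_mod_cast hA
  by_cases hne : ∃ t : ℝ, (A : ℝ) * t ^ 2 + B * t + C = 0
  · obtain ⟨s, hs⟩ := hne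
    refine (Set.toFinite {s, -B / A - s}).subset fun t ht => ?_
    have ht : (A : ℝ) * t ^ 2 + B * t + C = 0 := ht
    have hf : (t - s) * (A * (t + s) + B) = 0 := by linear_combination ht - hs
    rcases mul_eq_zero.mp hf with e | e
    · exact Or.inl (by linarith)
    · right
      rw [Set.mem_singleton_iff]
      field_simp
      linarith
  · convert Set.finite_empty (α := ℝ)
    ext t
    simpa using fun e => hne ⟨t, e⟩

/-- There are finitely many quadratic irrationals in the unit interval of given discriminant whose
conjugate lies outside the unit interval. -/
lemma finite_reduced (Δ : ℤ) :
    {t : ℝ | ∃ (A : ℤ) (t' : ℝ), IsQuadPair Δ A t t' ∧ t' ∉ Set.Icc (0 : ℝ) 1}.Finite := by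
  let I := Set.Icc (-(5 * Δ)) (5 * Δ)
  have hI : I.Finite := Set.finite_Icc _ _
  have hbox : ((I ×ˢ I ×ˢ I) ∩ {x : ℤ × ℤ × ℤ | x.1 ≠ 0}).Finite :=
    (hI.prod (hI.prod hI)).inter_of_left _
  refine (hbox.biUnion fun x hx => finite_quadratic_roots hx.2 x.2.1 x.2.2).subset ?_
  rintro t ⟨A, t', ⟨hirr, hmem, hA, B, C, hB, hC, hΔ⟩, ho⟩
  have hA' : (A : ℝ) ≠ 0 := by exact_mod_cast hA
  have hpos : 0 < t := lt_of_le_of_ne hmem.1 (Ne.symm hirr.ne_zero)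
  have hlt : t < 1 := lt_of_le_of_ne hmem.2 hirr.ne_one
  have hneg' : t' * (1 - t') < 0 := by
    by_contra! hc
    apply ho
    constructor <;> by_contra! <;> nlinarith
  have hneg : C * (A + B + C) < 0 := by
    have : ((C * (A + B + C) : ℤ) : ℝ) < 0 := by
      push_cast
      have e : (C : ℝ) * (A + B + C) = (A ^ 2 * (t * (1 - t))) * (t' * (1 - t')) := by
        rw [hB, hC]; ring
      rw [e]
      have : 0 < 1 - t := by linarith
      exact mul_neg_of_pos_of_neg (by positivity) hneg'
    exact_mod_cast this
  have hΔ' : (B + 2 * C) ^ 2 - 4 * (C * (A + B + C)) = Δ := by rw [← hΔ]; ring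
  have habs : |C| * |A + B + C| = -(C * (A + B + C)) := by rw [← abs_mul, abs_of_neg hneg]
  have h1 : 1 ≤ |C| := Int.one_le_abs (by rintro rfl; simp at hneg)
  have h2 : 1 ≤ |A + B + C| := Int.one_le_abs (by intro h; simp [h] at hneg)
  have b1 : |C| ≤ Δ := by nlinarith [sq_nonneg (B + 2 * C)]
  have b2 : |A + B + C| ≤ Δ := by nlinarith [sq_nonneg (B + 2 * C)]
  have b3 : |B + 2 * C| ≤ Δ := by
    have : |B + 2 * C| ≤ (B + 2 * C) ^ 2 := by
      rw [← sq_abs]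
      exact Int.le_self_sq _
    linarith
  rw [abs_le] at b1 b2 b3
  simp only [Set.mem_iUnion]
  refine ⟨(A, B, C), ⟨⟨⟨?_, ?_⟩, ⟨?_, ?_⟩, ⟨?_, ?_⟩⟩, hA⟩, ?_⟩
  any_goals (dsimp only; omega)
  change (A : ℝ) * t ^ 2 + B * t + C = 0
  rw [hB, hC]
  ring

lemma eventually_periodic_of_mem_quadField {D : ℤ} {hD : 0 < D} {t : ℝ}
    (ht : t ∈ Set.Icc (0 : ℝ) 1) (h : t ∈ quadField D hD) :
    ∃ n k : ℕ, 1 ≤ k ∧ slopeMap^[n + k] t = slopeMap^[n] t := by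
  by_cases hirr : Irrational t
  · obtain ⟨a, b, hab⟩ := h
    have hs : Real.sqrt (D : ℝ) ^ 2 = D := Real.sq_sqrt (by exact_mod_cast hD.le)
    have ha : (a.den : ℝ) ≠ 0 := by exact_mod_cast a.den_ne_zero
    have hb : (b.den : ℝ) ≠ 0 := by exact_mod_cast b.den_ne_zero
    obtain ⟨Δ, hpair⟩ : ∃ Δ, IsQuadPair Δ (((a.den : ℤ) * b.den) ^ 2) t (a - b * Real.sqrt D) := by
      refine ⟨_, hirr, ht, ?_, -2 * a.num * a.den * b.den ^ 2,
        a.num ^ 2 * b.den ^ 2 - b.num ^ 2 * a.den ^ 2 * D, ?_, ?_, rfl⟩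
      · have h1 := a.den_ne_zero
        have h2 := b.den_ne_zero
        positivity
      · rw [hab, Rat.cast_def a]
        push_cast
        field_simp
        ring
      · have e : t * (a - b * Real.sqrt D) = (a : ℝ) ^ 2 - b ^ 2 * D := by
          rw [hab]; linear_combination -(b : ℝ) ^ 2 * hs
        rw [e, Rat.cast_def a, Rat.cast_def b]
        push_cast
        field_simp
    obtain ⟨n, A', s', hn, ho⟩ := hpair.exists_iterate_reduced
    refine eventually_periodic_of_finite (finite_reduced Δ) n fun m => ?_
    rw [Function.iterate_add_apply]
    exact hn.iterate_reduced ho m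
  · obtain ⟨x, rfl⟩ := not_not.mp hirr
    exact eventually_periodic_of_rational ht

end Romik

/-- Lagrange's theorem for the Romik system. -/
theorem stmt_17 (α β : ℝ) (hα : 0 ≤ α) (hβ : 0 ≤ β) (hcirc : α ^ 2 + β ^ 2 = 1) :
    (∃ n k : ℕ, 1 ≤ k ∧ RomikT^[n + k] (α, β) = RomikT^[n] (α, β)) ↔
    (∃ D : ℤ, 0 < D ∧ Squarefree D ∧
      ∃ a b c e : ℚ, α = (a : ℝ) + (b : ℝ) * Real.sqrt (D : ℝ) ∧
        β = (c : ℝ) + (e : ℝ) * Real.sqrt (D : ℝ)) := by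
  have hα1 : 0 < 1 + α := by linarith
  obtain ⟨t, htdef⟩ : ∃ t, t = β / (1 + α) := ⟨_, rfl⟩
  have ht : t ∈ Set.Icc (0 : ℝ) 1 := by
    rw [htdef]
    exact ⟨by positivity, by rw [div_le_one hα1]; nlinarith⟩
  have hden : 1 + t ^ 2 = 2 / (1 + α) := by
    rw [htdef]; field_simp; linear_combination hcirc
  have hpt : (α, β) = Romik.circlePoint t := by
    have hnum : 1 - t ^ 2 = 2 * α / (1 + α) := by
      have : 2 * α / (1 + α) = 2 - 2 / (1 + α) := by field_simp; ring
      rw [this, ← hden]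
      ring
    unfold Romik.circlePoint
    rw [hden, hnum, htdef]
    congr 1 <;> field_simp
  have hiter (n k : ℕ) : RomikT^[n + k] (α, β) = RomikT^[n] (α, β) ↔
      Romik.slopeMap^[n + k] t = Romik.slopeMap^[n] t := by
    rw [hpt, Romik.iterate_romikT_circlePoint ht, Romik.iterate_romikT_circlePoint ht,
      Romik.circlePoint_injective.eq_iff]
  simp only [hiter]
  constructor
  · rintro ⟨n, k, hk, h⟩
    obtain ⟨D, hD, hsq, hmem⟩ := Romik.exists_mem_quadField_of_eventually_periodic ht hk h
    have h2 : t ^ 2 ∈ Romik.quadField D hD := pow_mem hmem 2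
    obtain ⟨a, b, hab⟩ : (Romik.circlePoint t).1 ∈ Romik.quadField D hD :=
      div_mem (sub_mem (one_mem _) h2) (add_mem (one_mem _) h2)
    obtain ⟨c, e, hce⟩ : (Romik.circlePoint t).2 ∈ Romik.quadField D hD :=
      div_mem (mul_mem (ofNat_mem _ 2) hmem) (add_mem (one_mem _) h2)
    rw [← hpt] at hab hce
    exact ⟨D, hD, hsq, a, b, c, e, hab, hce⟩
  · rintro ⟨D, hD, -, a, b, c, e, hab, hce⟩
    have h1 : α ∈ Romik.quadField D hD := ⟨a, b, hab⟩
    have h2 : β ∈ Romik.quadField D hD := ⟨c, e, hce⟩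
    refine Romik.eventually_periodic_of_mem_quadField (hD := hD) ht ?_
    rw [htdef]
    exact div_mem h2 (add_mem (one_mem _) h1)
end

section
/- (Galois' theorem for the Romik system) Let D ≥ 2 be a squarefree integer and a, b, c, e ∈ ℚ; let α = a + b·√D, β = c + e·√D, and suppose P = (α, β) lies on the closed unit quarter circle, α is irrational, and T^k(P) = P for some k ≥ 1. Assume that for each j = 1, …, k the x-coordinate of T^{j−1}(P) is different from 3/5 and 4/5, and let d_j ∈ {1,2,3} be the Romik digit of T^{j−1}(P) (d = 1 if x > 4/5, d = 2 if 3/5 < x < 4/5, d = 3 if x < 3/5). Set α^σ = a − b·√D and β^σ = c − e·√D. Then: (i) if d_k = 1 then α^σ > 0 and β^σ < 0; if d_k = 2 then α^σ < 0 and β^σ < 0; if d_k = 3 then α^σ < 0 and β^σ > 0; and (ii) the point P' = (|α^σ|, |β^σ|) lies on the closed unit quarter circle, satisfies T^k(P') = P', and its digit sequence is the reversed-and-rotated period: for j = 1, …, k−1 the Romik digit of T^{j−1}(P') equals d_{k−j}, and the Romik digit of T^{k−1}(P') equals d_k. -/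
/-- The Romik digit of a point of the quarter circle with first coordinate `x`
(well-defined away from the boundary values 3/5 and 4/5). -/
noncomputable def digit (x : ℝ) : ℕ :=
  if 4 / 5 < x then 1 else if 3 / 5 < x then 2 else 3

/-- The sign of the first coordinate of `(2 - x - 2 * y, 2 - 2 * x - y)` on the quarter circle. -/
noncomputable def signFst (x : ℝ) : ℝ := if 4 / 5 < x then 1 else -1

/-- The sign of the second coordinate of `(2 - x - 2 * y, 2 - 2 * x - y)` on the quarter circle. -/
noncomputable def signSnd (x : ℝ) : ℝ := if 3 / 5 < x then -1 else 1

/-- The branch of the Romik map selected by the digit of `p`, extended to the circle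
and applied to `q`. -/
noncomputable def branch (p q : ℝ × ℝ) : ℝ × ℝ :=
  (signFst p.1 * ((2 - q.1 - 2 * q.2) / (3 - 2 * q.1 - 2 * q.2)),
   signSnd p.1 * ((2 - 2 * q.1 - q.2) / (3 - 2 * q.1 - 2 * q.2)))

/-- The unit circle. -/
def OnCircle (q : ℝ × ℝ) : Prop := q.1 ^ 2 + q.2 ^ 2 = 1

/-- The closed first quadrant. -/
def InQuadrant (q : ℝ × ℝ) : Prop := 0 ≤ q.1 ∧ 0 ≤ q.2

/-- Coordinatewise absolute value. -/
def absPair (q : ℝ × ℝ) : ℝ × ℝ := (|q.1|, |q.2|)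

/-- `x' = a - b * s` is the conjugate of `x = a + b * s`. -/
def QuadConj (s x x' : ℝ) : Prop := ∃ a b : ℚ, x = a + b * s ∧ x' = a - b * s

lemma signFst_cases (x : ℝ) : signFst x = 1 ∨ signFst x = -1 := by
  unfold signFst; split_ifs <;> simp

lemma signSnd_cases (x : ℝ) : signSnd x = 1 ∨ signSnd x = -1 := by
  unfold signSnd; split_ifs <;> simp

lemma signFst_sq (x : ℝ) : signFst x ^ 2 = 1 := by
  rcases signFst_cases x with h | h <;> norm_num [h]

lemma signSnd_sq (x : ℝ) : signSnd x ^ 2 = 1 := by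
  rcases signSnd_cases x with h | h <;> norm_num [h]

lemma OnCircle.denom_pos {q : ℝ × ℝ} (h : OnCircle q) : 0 < 3 - 2 * q.1 - 2 * q.2 := by
  unfold OnCircle at h
  nlinarith [sq_nonneg (q.1 - q.2), sq_nonneg (q.1 + q.2 - 3 / 2)]

lemma OnCircle.branch {q : ℝ × ℝ} (h : OnCircle q) (p : ℝ × ℝ) : OnCircle (branch p q) := by
  have hd := h.denom_pos
  unfold OnCircle at h ⊢
  simp only [_root_.branch, mul_pow, signFst_sq, signSnd_sq, one_mul]
  field_simp
  linear_combination h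

lemma OnCircle.romikT {q : ℝ × ℝ} (h : OnCircle q) : OnCircle (RomikT q) := by
  have hd := h.denom_pos
  unfold OnCircle at h ⊢
  simp only [RomikT, div_pow, sq_abs]
  field_simp
  linear_combination h

lemma OnCircle.romikT_inQuadrant {q : ℝ × ℝ} (h : OnCircle q) : InQuadrant (RomikT q) :=
  ⟨div_nonneg (abs_nonneg _) h.denom_pos.le, div_nonneg (abs_nonneg _) h.denom_pos.le⟩

lemma romikT_eq_branch {p : ℝ × ℝ} (h : OnCircle p) (hp : InQuadrant p) :
    RomikT p = branch p p := by
  have h1 : |2 - p.1 - 2 * p.2| = signFst p.1 * (2 - p.1 - 2 * p.2) := by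
    obtain ⟨hx, hy⟩ := hp
    unfold OnCircle at h
    have hx1 : p.1 ≤ 1 := by nlinarith
    unfold signFst
    split_ifs with hc
    · rw [abs_of_nonneg (by nlinarith), one_mul]
    · rw [abs_of_nonpos (by nlinarith), neg_one_mul]
  have h2 : |2 - 2 * p.1 - p.2| = signSnd p.1 * (2 - 2 * p.1 - p.2) := by
    obtain ⟨hx, hy⟩ := hp
    unfold OnCircle at h
    unfold signSnd
    split_ifs with hc
    · rw [abs_of_nonpos (by nlinarith), neg_one_mul]
    · rw [abs_of_nonneg (by nlinarith), one_mul]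
  simp only [RomikT, branch, h1, h2, mul_div_assoc]

lemma pos_of_not_inQuadrant {q : ℝ × ℝ} (h : OnCircle q) (hq : ¬ InQuadrant q) :
    0 < 2 - q.1 - 2 * q.2 ∧ 0 < 2 - 2 * q.1 - q.2 := by
  unfold OnCircle at h
  have hx : q.1 ≤ 1 := by nlinarith [sq_nonneg q.2]
  have hy : q.2 ≤ 1 := by nlinarith [sq_nonneg q.1]
  rw [InQuadrant, not_and_or, not_le, not_le] at hq
  rcases hq with hq | hq <;> constructor <;> linarith

/-- Off the closed quadrant, the signs of a branch are those prescribed by its digit. -/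
lemma exists_branch_eq {q : ℝ × ℝ} (h : OnCircle q) (hq : ¬ InQuadrant q) (p : ℝ × ℝ) :
    ∃ u v : ℝ, 0 < u ∧ 0 < v ∧ branch p q = (signFst p.1 * u, signSnd p.1 * v) := by
  have hd := h.denom_pos
  obtain ⟨h1, h2⟩ := pos_of_not_inQuadrant h hq
  exact ⟨_, _, div_pos h1 hd, div_pos h2 hd, rfl⟩

lemma not_inQuadrant_branch {q : ℝ × ℝ} (h : OnCircle q) (hq : ¬ InQuadrant q) (p : ℝ × ℝ) :
    ¬ InQuadrant (branch p q) := by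
  obtain ⟨u, v, hu, hv, hb⟩ := exists_branch_eq h hq p
  rw [hb]
  rintro ⟨hx, hy⟩
  simp only [signFst, signSnd] at hx hy
  split_ifs at hx hy <;> linarith

lemma absPair_branch {q : ℝ × ℝ} (h : OnCircle q) (hq : ¬ InQuadrant q) (p : ℝ × ℝ) :
    absPair (branch p q) = ((2 - q.1 - 2 * q.2) / (3 - 2 * q.1 - 2 * q.2),
      (2 - 2 * q.1 - q.2) / (3 - 2 * q.1 - 2 * q.2)) := by
  have hd := h.denom_pos
  obtain ⟨h1, h2⟩ := pos_of_not_inQuadrant h hq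
  have hs1 : |signFst p.1| = 1 := by rcases signFst_cases p.1 with h | h <;> simp [h]
  have hs2 : |signSnd p.1| = 1 := by rcases signSnd_cases p.1 with h | h <;> simp [h]
  simp only [absPair, branch, abs_mul, hs1, hs2, one_mul, abs_of_pos (div_pos h1 hd),
    abs_of_pos (div_pos h2 hd)]

/-- The unsigned Romik transformation is an involution. -/
lemma involution_absPair_branch {q r : ℝ × ℝ} (h : OnCircle q) (hq : ¬ InQuadrant q)
    (p : ℝ × ℝ) (hr : r = absPair (branch p q)) :
    (2 - r.1 - 2 * r.2) / (3 - 2 * r.1 - 2 * r.2) = q.1 ∧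
      (2 - 2 * r.1 - r.2) / (3 - 2 * r.1 - 2 * r.2) = q.2 := by
  have hd := h.denom_pos
  rw [absPair_branch h hq] at hr
  have hden : 3 - 2 * r.1 - 2 * r.2 = 1 / (3 - 2 * q.1 - 2 * q.2) := by
    rw [hr]; field_simp; ring
  rw [hden, hr]
  constructor <;> · field_simp; ring

lemma OnCircle.absPair {q : ℝ × ℝ} (h : OnCircle q) : OnCircle (absPair q) := by
  simpa [OnCircle, _root_.absPair] using h

lemma romikT_absPair_branch {q : ℝ × ℝ} (h : OnCircle q) (hq : ¬ InQuadrant q) (p : ℝ × ℝ) :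
    RomikT (absPair (branch p q)) = absPair q := by
  obtain ⟨h1, h2⟩ := involution_absPair_branch h hq p rfl
  have hd := (h.branch p).absPair.denom_pos
  rw [absPair.eq_def q, ← h1, ← h2, abs_div, abs_div, abs_of_pos hd, RomikT]

lemma digit_eq_of_signs {p r : ℝ × ℝ} (h : OnCircle r) (hr : InQuadrant r)
    (h1 : 0 < signFst p.1 * (2 - r.1 - 2 * r.2)) (h2 : 0 < signSnd p.1 * (2 - 2 * r.1 - r.2)) :
    digit r.1 = digit p.1 := by
  have e1 : 4 / 5 < p.1 ↔ 4 / 5 < r.1 := by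
    obtain ⟨hx, hy⟩ := hr
    unfold OnCircle at h
    have hx1 : r.1 ≤ 1 := by nlinarith
    unfold signFst at h1
    split_ifs at h1 with hc
    · simp only [hc, true_iff]; nlinarith
    · simp only [hc, false_iff]; intro; nlinarith
  have e2 : 3 / 5 < p.1 ↔ 3 / 5 < r.1 := by
    obtain ⟨hx, hy⟩ := hr
    unfold OnCircle at h
    unfold signSnd at h2
    split_ifs at h2 with hc
    · simp only [hc, true_iff]; nlinarith
    · simp only [hc, false_iff]; intro; nlinarith
  simp only [digit, e1, e2]

lemma digit_absPair_branch_branch {q : ℝ × ℝ} (h : OnCircle q) (hq : ¬ InQuadrant q)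
    (p p' : ℝ × ℝ) : digit (absPair (branch p' (branch p q))).1 = digit p.1 := by
  have hb := h.branch p
  have hc := (hb.branch p').absPair
  obtain ⟨h1, h2⟩ := involution_absPair_branch hb (not_inQuadrant_branch h hq p) p' rfl
  obtain ⟨u, v, hu, hv, huv⟩ := exists_branch_eq h hq p
  have hfst : (branch p q).1 = signFst p.1 * u := congrArg Prod.fst huv
  have hsnd : (branch p q).2 = signSnd p.1 * v := congrArg Prod.snd huv
  have hd := hc.denom_pos
  rw [div_eq_iff hd.ne'] at h1 h2
  refine digit_eq_of_signs hc ⟨abs_nonneg _, abs_nonneg _⟩ ?_ ?_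
  · rw [h1, hfst, ← mul_assoc, ← mul_assoc, ← sq, signFst_sq, one_mul]; exact mul_pos hu hd
  · rw [h2, hsnd, ← mul_assoc, ← mul_assoc, ← sq, signSnd_sq, one_mul]; exact mul_pos hv hd

/-- The branches scale the Minkowski pairing `1 - ⟨q, r⟩`. -/
lemma pairing_branch {q r : ℝ × ℝ} (hq : OnCircle q) (hr : OnCircle r) (p : ℝ × ℝ) :
    1 - q.1 * r.1 - q.2 * r.2 =
      (3 - 2 * q.1 - 2 * q.2) * (3 - 2 * r.1 - 2 * r.2) *
        (1 - (branch p q).1 * (branch p r).1 - (branch p q).2 * (branch p r).2) := by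
  have h1 := hq.denom_pos
  have h2 := hr.denom_pos
  have e1 := signFst_sq p.1
  have e2 := signSnd_sq p.1
  simp only [branch]
  have cancel (A B u v u' v' : ℝ) (hA : 0 < A) (hB : 0 < B) :
      A * B * (1 - signFst p.1 * (u / A) * (signFst p.1 * (v / B)) -
        signSnd p.1 * (u' / A) * (signSnd p.1 * (v' / B))) = A * B - u * v - u' * v' := by
    field_simp
    rw [e1, e2]
    ring
  rw [cancel _ _ _ _ _ _ h1 h2]
  ring

lemma pairing_nonneg {q r : ℝ × ℝ} (hq : OnCircle q) (hr : OnCircle r) :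
    0 ≤ 1 - q.1 * r.1 - q.2 * r.2 := by
  unfold OnCircle at hq hr
  nlinarith [sq_nonneg (q.1 - r.1), sq_nonneg (q.2 - r.2)]

lemma denom_le_one {q : ℝ × ℝ} (hq : OnCircle q) (h : InQuadrant q) :
    3 - 2 * q.1 - 2 * q.2 ≤ 1 := by
  obtain ⟨hx, hy⟩ := h
  unfold OnCircle at hq
  nlinarith [mul_nonneg hx hy]

lemma pairing_le_branch {q r : ℝ × ℝ} (hq : OnCircle q) (hr : OnCircle r)
    (hq' : InQuadrant q) (hr' : InQuadrant r) (p : ℝ × ℝ) :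
    1 - q.1 * r.1 - q.2 * r.2 ≤
      1 - (branch p q).1 * (branch p r).1 - (branch p q).2 * (branch p r).2 := by
  rw [pairing_branch hq hr p]
  exact mul_le_of_le_one_left (pairing_nonneg (hq.branch p) (hr.branch p))
    (mul_le_one₀ (denom_le_one hq hq') hr.denom_pos.le (denom_le_one hr hr'))

lemma eq_of_pairing_le_zero {q r : ℝ × ℝ} (hq : OnCircle q) (hr : OnCircle r)
    (h : 1 - q.1 * r.1 - q.2 * r.2 ≤ 0) : q.1 = r.1 := by
  unfold OnCircle at hq hr
  nlinarith [sq_nonneg (q.1 - r.1), sq_nonneg (q.2 - r.2)]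

namespace QuadConj

variable {s x x' y y' : ℝ}

lemma ratCast (s : ℝ) (q : ℚ) : QuadConj s q q := ⟨q, 0, by simp, by simp⟩

lemma add (hx : QuadConj s x x') (hy : QuadConj s y y') : QuadConj s (x + y) (x' + y') := by
  obtain ⟨a, b, rfl, rfl⟩ := hx
  obtain ⟨c, e, rfl, rfl⟩ := hy
  exact ⟨a + c, b + e, by push_cast; ring, by push_cast; ring⟩

lemma mul {D : ℤ} (hs : s ^ 2 = D) (hx : QuadConj s x x') (hy : QuadConj s y y') :
    QuadConj s (x * y) (x' * y') := by
  obtain ⟨a, b, rfl, rfl⟩ := hx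
  obtain ⟨c, e, rfl, rfl⟩ := hy
  refine ⟨a * c + b * e * D, a * e + b * c, ?_, ?_⟩ <;> push_cast <;>
    linear_combination (b * e : ℝ) * hs

lemma eq_zero_and_eq_zero (hs : Irrational s) {a b : ℚ} (h : (a : ℝ) + b * s = 0) :
    a = 0 ∧ b = 0 := by
  have hb : b = 0 := by
    by_contra hb
    refine hs ⟨-a / b, ?_⟩
    have : (b : ℝ) ≠ 0 := by exact_mod_cast hb
    push_cast
    rw [div_eq_iff this]
    linarith
  subst hb
  exact ⟨by simpa using h, rfl⟩

lemma unique (hs : Irrational s) {z : ℝ} (hx : QuadConj s x y) (hx' : QuadConj s x z) :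
    y = z := by
  obtain ⟨a, b, rfl, rfl⟩ := hx
  obtain ⟨c, e, h, rfl⟩ := hx'
  obtain ⟨h1, h2⟩ := eq_zero_and_eq_zero hs (a := a - c) (b := b - e) (by push_cast; linarith)
  rw [sub_eq_zero.1 h1, sub_eq_zero.1 h2]

lemma div {D : ℤ} (hs : s ^ 2 = D) (hx : QuadConj s x x') (hy : QuadConj s y y')
    (h0 : y ≠ 0) (h0' : y' ≠ 0) : QuadConj s (x / y) (x' / y') := by
  have hinv : QuadConj s y⁻¹ y'⁻¹ := by
    obtain ⟨c, e, rfl, rfl⟩ := hy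
    have hn : (c : ℝ) ^ 2 - D * e ^ 2 = (c + e * s) * (c - e * s) := by
      linear_combination (e : ℝ) ^ 2 * hs
    refine ⟨c / (c ^ 2 - D * e ^ 2), -e / (c ^ 2 - D * e ^ 2), ?_, ?_⟩ <;> push_cast <;>
      rw [hn] <;> field_simp <;> ring
  simpa [div_eq_mul_inv] using hx.mul hs hinv

end QuadConj

lemma quadConj_branch {s : ℝ} {D : ℤ} (hs : s ^ 2 = D) {q q' : ℝ × ℝ} (hq : OnCircle q)
    (hq' : OnCircle q') (h1 : QuadConj s q.1 q'.1) (h2 : QuadConj s q.2 q'.2) (p : ℝ × ℝ) :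
    QuadConj s (branch p q).1 (branch p q').1 ∧ QuadConj s (branch p q).2 (branch p q').2 := by
  have lin (l m n : ℚ) : QuadConj s (l + m * q.1 + n * q.2) (l + m * q'.1 + n * q'.2) :=
    ((QuadConj.ratCast s l).add ((QuadConj.ratCast s m).mul hs h1)).add
      ((QuadConj.ratCast s n).mul hs h2)
  have hden : QuadConj s (3 - 2 * q.1 - 2 * q.2) (3 - 2 * q'.1 - 2 * q'.2) := by
    convert lin 3 (-2) (-2) using 1 <;> push_cast <;> ring
  have hfst : QuadConj s (2 - q.1 - 2 * q.2) (2 - q'.1 - 2 * q'.2) := by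
    convert lin 2 (-1) (-2) using 1 <;> push_cast <;> ring
  have hsnd : QuadConj s (2 - 2 * q.1 - q.2) (2 - 2 * q'.1 - q'.2) := by
    convert lin 2 (-2) (-1) using 1 <;> push_cast <;> ring
  have hs1 : QuadConj s (signFst p.1) (signFst p.1) := by
    rcases signFst_cases p.1 with h | h <;> rw [h]
    · simpa using QuadConj.ratCast s 1
    · simpa using QuadConj.ratCast s (-1)
  have hs2 : QuadConj s (signSnd p.1) (signSnd p.1) := by
    rcases signSnd_cases p.1 with h | h <;> rw [h]
    · simpa using QuadConj.ratCast s 1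
    · simpa using QuadConj.ratCast s (-1)
  have hd := hq.denom_pos.ne'
  have hd' := hq'.denom_pos.ne'
  exact ⟨hs1.mul hs (hfst.div hs hden hd hd'), hs2.mul hs (hsnd.div hs hden hd hd')⟩

section Companion

/-- The orbit of `q` under the branches selected by the Romik orbit of `p`. -/
noncomputable def companion (p q : ℝ × ℝ) : ℕ → ℝ × ℝ
  | 0 => q
  | n + 1 => branch (RomikT^[n] p) (companion p q n)

variable {p q : ℝ × ℝ}

lemma onCircle_iterate (hp : OnCircle p) (n : ℕ) : OnCircle (RomikT^[n] p) := by
  induction n with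
  | zero => exact hp
  | succ n ih => rw [Function.iterate_succ_apply']; exact ih.romikT

lemma inQuadrant_iterate (hp : OnCircle p) (hp' : InQuadrant p) (n : ℕ) :
    InQuadrant (RomikT^[n] p) := by
  cases n with
  | zero => exact hp'
  | succ n =>
    rw [Function.iterate_succ_apply']
    exact (onCircle_iterate hp n).romikT_inQuadrant

lemma iterate_succ_eq_branch (hp : OnCircle p) (hp' : InQuadrant p) (n : ℕ) :
    RomikT^[n + 1] p = branch (RomikT^[n] p) (RomikT^[n] p) := by
  rw [Function.iterate_succ_apply',
    romikT_eq_branch (onCircle_iterate hp n) (inQuadrant_iterate hp hp' n)]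

lemma onCircle_companion (hq : OnCircle q) (n : ℕ) : OnCircle (companion p q n) := by
  induction n with
  | zero => exact hq
  | succ n ih => exact ih.branch _

lemma quadConj_companion {s : ℝ} {D : ℤ} (hs : s ^ 2 = D) (hp : OnCircle p) (hp' : InQuadrant p)
    (hq : OnCircle q) (h1 : QuadConj s p.1 q.1) (h2 : QuadConj s p.2 q.2) (n : ℕ) :
    QuadConj s (RomikT^[n] p).1 (companion p q n).1 ∧
      QuadConj s (RomikT^[n] p).2 (companion p q n).2 := by
  induction n with
  | zero => exact ⟨h1, h2⟩
  | succ n ih =>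
    rw [iterate_succ_eq_branch hp hp']
    exact quadConj_branch hs (onCircle_iterate hp n) (onCircle_companion hq n) ih.1 ih.2 _

lemma not_inQuadrant_companion_of_le (hq : OnCircle q) {m n : ℕ} (hmn : m ≤ n)
    (h : ¬ InQuadrant (companion p q m)) : ¬ InQuadrant (companion p q n) := by
  induction n, hmn using Nat.le_induction with
  | base => exact h
  | succ n _ ih => exact not_inQuadrant_branch (onCircle_companion hq n) ih _

/-- A companion orbit closing up with the same period as the orbit of `p ≠ q` starts outside
the closed quadrant, since the branches expand pairs of points of the quarter circle. -/
lemma not_inQuadrant_of_companion_eq (hp : OnCircle p) (hp' : InQuadrant p) (hq : OnCircle q)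
    (hx : 0 < p.1) (hy : 0 < p.2) (hne : p.1 ≠ q.1) {k : ℕ} (hk : 1 ≤ k)
    (hpk : RomikT^[k] p = p) (hqk : companion p q k = q) : ¬ InQuadrant q := by
  intro hq'
  have hin (n : ℕ) (hn : n ≤ k) : InQuadrant (companion p q n) := by
    by_contra h
    exact not_inQuadrant_companion_of_le hq hn h (hqk.symm ▸ hq')
  let f : ℕ → ℝ := fun n =>
    1 - (RomikT^[n] p).1 * (companion p q n).1 - (RomikT^[n] p).2 * (companion p q n).2
  have hmono (n : ℕ) (hn : 1 ≤ n) : n ≤ k → f 1 ≤ f n := by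
    induction n, hn using Nat.le_induction with
    | base => exact fun _ => le_rfl
    | succ n _ ih =>
      intro hnk
      refine (ih (by omega)).trans ?_
      simp only [f]
      rw [iterate_succ_eq_branch hp hp']
      exact pairing_le_branch (onCircle_iterate hp n) (onCircle_companion hq n)
        (inQuadrant_iterate hp hp' n) (hin n (by omega)) _
  have hk0 : f k = f 0 := by simp only [f, hpk, hqk]; rfl
  have hf0 : 0 < f 0 := by
    by_contra h
    exact hne (eq_of_pairing_le_zero hp hq (not_lt.1 h))
  have h01 : f 0 = (3 - 2 * p.1 - 2 * p.2) * (3 - 2 * q.1 - 2 * q.2) * f 1 := by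
    simp only [f]
    rw [iterate_succ_eq_branch hp hp' 0]
    exact pairing_branch hp hq p
  have hp1 : 3 - 2 * p.1 - 2 * p.2 < 1 := by
    unfold OnCircle at hp
    nlinarith [mul_pos hx hy]
  have hlt : (3 - 2 * p.1 - 2 * p.2) * (3 - 2 * q.1 - 2 * q.2) < 1 :=
    mul_lt_one_of_nonneg_of_lt_one_left hp.denom_pos.le hp1 (denom_le_one hq hq')
  have hf1 : 0 < f 1 :=
    (mul_pos_iff_of_pos_left (mul_pos hp.denom_pos hq.denom_pos)).1 (h01 ▸ hf0)
  have := hmono k hk le_rfl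
  have := mul_lt_of_lt_one_left hf1 hlt
  linarith

lemma romikT_iterate_absPair_companion (hq : OnCircle q) (hq' : ¬ InQuadrant q) (n j : ℕ) :
    RomikT^[j] (absPair (companion p q (n + j))) = absPair (companion p q n) := by
  induction j with
  | zero => rfl
  | succ j ih =>
    rw [Function.iterate_succ_apply, ← add_assoc, companion,
      romikT_absPair_branch (onCircle_companion hq _)
        (not_inQuadrant_companion_of_le hq (Nat.zero_le _) hq'), ih]

lemma digit_absPair_companion (hq : OnCircle q) (hq' : ¬ InQuadrant q) (n : ℕ) :
    digit (absPair (companion p q (n + 2))).1 = digit (RomikT^[n] p).1 :=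
  digit_absPair_branch_branch (onCircle_companion hq n)
    (not_inQuadrant_companion_of_le hq (Nat.zero_le _) hq') _ _

end Companion

/-- Galois' theorem for the Romik system. -/
theorem stmt_18 (D : ℤ) (hD : Squarefree D) (hD2 : 2 ≤ D) (a b c e : ℚ)
    (α β ασ βσ : ℝ)
    (hα : α = (a : ℝ) + (b : ℝ) * Real.sqrt (D : ℝ))
    (hβ : β = (c : ℝ) + (e : ℝ) * Real.sqrt (D : ℝ))
    (hασ : ασ = (a : ℝ) - (b : ℝ) * Real.sqrt (D : ℝ))
    (hβσ : βσ = (c : ℝ) - (e : ℝ) * Real.sqrt (D : ℝ))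
    (hα0 : 0 ≤ α) (hβ0 : 0 ≤ β) (hcirc : α ^ 2 + β ^ 2 = 1)
    (hirr : Irrational α)
    (k : ℕ) (hk : 1 ≤ k) (hper : RomikT^[k] (α, β) = (α, β))
    (hbdry : ∀ j < k, (RomikT^[j] (α, β)).1 ≠ 3 / 5 ∧ (RomikT^[j] (α, β)).1 ≠ 4 / 5) :
    (digit ((RomikT^[k - 1] (α, β)).1) = 1 → 0 < ασ ∧ βσ < 0) ∧
    (digit ((RomikT^[k - 1] (α, β)).1) = 2 → ασ < 0 ∧ βσ < 0) ∧
    (digit ((RomikT^[k - 1] (α, β)).1) = 3 → ασ < 0 ∧ 0 < βσ) ∧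
    |ασ| ^ 2 + |βσ| ^ 2 = 1 ∧
    RomikT^[k] (|ασ|, |βσ|) = (|ασ|, |βσ|) ∧
    (∀ j : ℕ, j + 1 < k →
      digit ((RomikT^[j] (|ασ|, |βσ|)).1) = digit ((RomikT^[k - j - 2] (α, β)).1)) ∧
    digit ((RomikT^[k - 1] (|ασ|, |βσ|)).1) = digit ((RomikT^[k - 1] (α, β)).1) := by
  have hDnn : (0 : ℝ) ≤ D := by exact_mod_cast (by omega : (0 : ℤ) ≤ D)
  have hs : Real.sqrt D ^ 2 = D := Real.sq_sqrt hDnn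
  have hsirr : Irrational (Real.sqrt D) := by
    refine irrational_sqrt_intCast_iff.2 ⟨?_, by omega⟩
    rintro ⟨m, rfl⟩
    rcases Int.isUnit_iff.1 (hD m dvd_rfl) with rfl | rfl <;> norm_num at hD2
  set s := Real.sqrt D
  set p : ℝ × ℝ := (α, β) with hp_def
  set q : ℝ × ℝ := (ασ, βσ) with hq_def
  have hp : OnCircle p := hcirc
  have hp' : InQuadrant p := ⟨hα0, hβ0⟩
  have h1 : QuadConj s p.1 q.1 := ⟨a, b, hα, hασ⟩
  have h2 : QuadConj s p.2 q.2 := ⟨c, e, hβ, hβσ⟩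
  have hq : OnCircle q := by
    have h := (h1.mul hs h1).add (h2.mul hs h2)
    have hone : p.1 * p.1 + p.2 * p.2 = ((1 : ℚ) : ℝ) := by
      push_cast; rw [← sq, ← sq]; exact hcirc
    rw [hone] at h
    have := h.unique hsirr (QuadConj.ratCast s 1)
    rw [OnCircle, sq, sq, this, Rat.cast_one]
  have hne : p.1 ≠ q.1 := by
    intro h
    have hbs : (b : ℝ) * s = 0 := by
      simp only [hp_def, hq_def] at h
      linarith
    exact hirr ⟨a, by rw [hα, hbs, add_zero]⟩
  have hx : 0 < p.1 := lt_of_le_of_ne hα0 hirr.ne_zero.symm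
  have hy : 0 < p.2 := by
    refine lt_of_le_of_ne hβ0 fun h => hirr.ne_one ?_
    have hβ' : β = 0 := h.symm
    rw [hβ'] at hcirc
    nlinarith
  have hconj := quadConj_companion hs hp hp' hq h1 h2
  have hperiod (n : ℕ) : companion p q (n + k) = companion p q n := by
    have h := hconj (n + k)
    rw [Function.iterate_add_apply, hper] at h
    exact Prod.ext (h.1.unique hsirr (hconj n).1) (h.2.unique hsirr (hconj n).2)
  have hqk : companion p q k = q := by simpa [companion] using hperiod 0
  have hq' : ¬ InQuadrant q := not_inQuadrant_of_companion_eq hp hp' hq hx hy hne hk hper hqk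
  have hiter (n j : ℕ) (hnj : n + j = k) :
      RomikT^[j] (|ασ|, |βσ|) = absPair (companion p q n) := by
    rw [← romikT_iterate_absPair_companion hq hq' n j, hnj, hqk]
    rfl
  obtain ⟨u, v, hu, hv, huv⟩ : ∃ u v : ℝ, 0 < u ∧ 0 < v ∧
      q = (signFst (RomikT^[k - 1] p).1 * u, signSnd (RomikT^[k - 1] p).1 * v) := by
    obtain ⟨m, rfl⟩ : ∃ m, k = m + 1 := ⟨k - 1, by omega⟩
    obtain ⟨u, v, hu, hv, huv⟩ := exists_branch_eq (onCircle_companion hq m)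
      (not_inQuadrant_companion_of_le hq (Nat.zero_le m) hq') (RomikT^[m] p)
    exact ⟨u, v, hu, hv, hqk.symm.trans huv⟩
  have hfst : ασ = signFst (RomikT^[k - 1] p).1 * u := congrArg Prod.fst huv
  have hsnd : βσ = signSnd (RomikT^[k - 1] p).1 * v := congrArg Prod.snd huv
  refine ⟨?_, ?_, ?_, hq.absPair, ?_, ?_, ?_⟩
  · rw [hfst, hsnd]
    unfold digit signFst signSnd
    split_ifs <;> intro h <;> first | omega | constructor <;> linarith
  · rw [hfst, hsnd]
    unfold digit signFst signSnd
    split_ifs <;> intro h <;> first | omega | constructor <;> linarith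
  · rw [hfst, hsnd]
    unfold digit signFst signSnd
    split_ifs <;> intro h <;> first | omega | constructor <;> linarith
  · exact hiter 0 k (zero_add k)
  · intro j hj
    rw [hiter (k - j - 2 + 2) j (by omega), digit_absPair_companion hq hq']
  · rw [hiter 1 (k - 1) (by omega), ← hperiod 1, show 1 + k = k - 1 + 2 by omega,
      digit_absPair_companion hq hq']
end
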